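/- Let A be a gentle algebra of rank n and let M be a maximal partial-tilting A-module, i.e. a partial-tilting module with exactly n − 1 pairwise non-isomorphic indecomposable direct summands. Then M admits only finitely many isomorphism classes of complements; more precisely, the number of isomorphism classes of indecomposable A-modules N with N ∉ add M and M ⊕ N a tilting module is at most 2n. In particular, the complement conjectures of Bongartz–Smalø/Happel–Unger and the modified Happel conjecture hold for gentle algebras. -/

import Mathlib

open CategoryTheory

universe u

/-- The combinatorial data of a gentle presentation: a finite quiver together with a
set of relations given by composable paths of length two, satisfying the gentle
conditions. -/
structure GentleQuiverData : Type (u + 1) where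
  /-- vertices -/
  V : Type u
  /-- arrows -/
  E : Type u
  fintV : Fintype V
  fintE : Fintype E
  /-- source -/
  src : E → V
  /-- target -/
  tgt : E → V
  /-- `rel a b` means that the length-two path `ab` is one of the generating relations -/
  rel : E → E → Prop
  rel_comp : ∀ a b, rel a b → tgt a = src b
  src_le_two : ∀ v : V, Set.ncard {a : E | src a = v} ≤ 2
  tgt_le_two : ∀ v : V, Set.ncard {a : E | tgt a = v} ≤ 2
  rel_right_unique : ∀ a b c, rel a b → rel a c → b = c
  rel_left_unique : ∀ a b c, rel b a → rel c a → b = c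
  nonrel_right_unique : ∀ a b c, tgt a = src b → ¬ rel a b → tgt a = src c → ¬ rel a c → b = c
  nonrel_left_unique : ∀ a b c, tgt b = src a → ¬ rel b a → tgt c = src a → ¬ rel c a → b = c

attribute [instance] GentleQuiverData.fintV GentleQuiverData.fintE

/-- The quiver is connected. -/
def GentleQuiverData.Connected (Q : GentleQuiverData.{u}) : Prop :=
  ∀ v w : Q.V, Relation.ReflTransGen
    (fun x y => ∃ a : Q.E, (Q.src a = x ∧ Q.tgt a = y) ∨ (Q.src a = y ∧ Q.tgt a = x)) v w

variable (k : Type u) [Field k]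

/-- The relations presenting the gentle algebra `kQ/I` as a quotient of the free algebra
on vertices and arrows: the vertices are orthogonal idempotents summing to `1`, arrows are
compatible with sources and targets, and the chosen length-two paths vanish. -/
inductive GentleRel (Q : GentleQuiverData.{u}) :
    FreeAlgebra k (Q.V ⊕ Q.E) → FreeAlgebra k (Q.V ⊕ Q.E) → Prop
  | idem (v : Q.V) :
      GentleRel Q (FreeAlgebra.ι k (Sum.inl v) * FreeAlgebra.ι k (Sum.inl v))
        (FreeAlgebra.ι k (Sum.inl v))
  | orth (v w : Q.V) : v ≠ w →
      GentleRel Q (FreeAlgebra.ι k (Sum.inl v) * FreeAlgebra.ι k (Sum.inl w)) 0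
  | sum_idem :
      GentleRel Q (∑ v : Q.V, FreeAlgebra.ι k (Sum.inl v)) 1
  | src_mul (a : Q.E) :
      GentleRel Q (FreeAlgebra.ι k (Sum.inl (Q.src a)) * FreeAlgebra.ι k (Sum.inr a))
        (FreeAlgebra.ι k (Sum.inr a))
  | mul_tgt (a : Q.E) :
      GentleRel Q (FreeAlgebra.ι k (Sum.inr a) * FreeAlgebra.ι k (Sum.inl (Q.tgt a)))
        (FreeAlgebra.ι k (Sum.inr a))
  | relation (a b : Q.E) : Q.rel a b →
      GentleRel Q (FreeAlgebra.ι k (Sum.inr a) * FreeAlgebra.ι k (Sum.inr b)) 0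

/-- The gentle algebra `kQ/I` associated to gentle quiver data. -/
abbrev GentleAlg (Q : GentleQuiverData.{u}) : Type u := RingQuot (GentleRel k Q)

section Modules

variable {B : Type u} [Ring B]

/-- `X` belongs to `add T`: it is a direct summand of a finite direct sum of copies of `T`. -/
def MemAdd (T X : ModuleCat.{u} B) : Prop :=
  ∃ (n : ℕ) (f : X →ₗ[B] (Fin n → T)) (g : (Fin n → T) →ₗ[B] X), g.comp f = LinearMap.id

/-- An indecomposable module: nonzero, and any direct sum decomposition is trivial. -/
def IsIndec (X : ModuleCat.{u} B) : Prop :=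
  Nontrivial X ∧ ∀ Y Z : ModuleCat.{u} B,
    Nonempty (X ≃ₗ[B] Y × Z) → Subsingleton Y ∨ Subsingleton Z

/-- `M` decomposes as the direct sum of the family `N` of pairwise non-isomorphic
indecomposable modules; in particular `M` is multiplicity-free. -/
def IsIndecDecomp (M : ModuleCat.{u} B) {m : ℕ} (N : Fin m → ModuleCat.{u} B) : Prop :=
  (∀ i, IsIndec (N i)) ∧
  (∀ i j, i ≠ j → IsEmpty (N i ≃ₗ[B] N j)) ∧
  Nonempty (M ≃ₗ[B] ((i : Fin m) → N i))

/-- `M` is multiplicity-free with exactly `m` pairwise non-isomorphic indecomposable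
direct summands. -/
def HasRank (M : ModuleCat.{u} B) (m : ℕ) : Prop :=
  ∃ N : Fin m → ModuleCat.{u} B, IsIndecDecomp M N

/-- Projective dimension at most `d`held via an explicit projective resolution. -/
def ProjDimLE : ModuleCat.{u} B → ℕ → Prop
  | X, 0 => Module.Projective B X
  | X, (d + 1) => ∃ P : ModuleCat.{u} B, Module.Projective B P ∧
      ∃ f : P →ₗ[B] X, Function.Surjective f ∧ ProjDimLE (ModuleCat.of B (LinearMap.ker f)) d

/-- (T1): finite projective dimension. -/
def HasFiniteProjDim (X : ModuleCat.{u} B) : Prop := ∃ d, ProjDimLE X d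

/-- There is an exact sequence `0 → X → T₀ → ⋯ → T_d → 0` with all `Tᵢ` in `add T`. -/
def CoresolvedBy (T : ModuleCat.{u} B) : ModuleCat.{u} B → ℕ → Prop
  | X, 0 => MemAdd T X
  | X, (d + 1) => ∃ T₀ : ModuleCat.{u} B, MemAdd T T₀ ∧
      ∃ f : X →ₗ[B] T₀, Function.Injective f ∧
        CoresolvedBy T (ModuleCat.of B (T₀ ⧸ LinearMap.range f)) d

/-- The Ext-group `Ext^n_B(X, Y)`. -/
noncomputable def ExtGroup (X Y : ModuleCat.{u} B) (n : ℕ) : Type (u + 1) :=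
  letI : HasDerivedCategory.{u + 1} (ModuleCat.{u} B) := HasDerivedCategory.standard _
  letI : HasExt.{u + 1} (ModuleCat.{u} B) := hasExt_of_hasDerivedCategory _
  Abelian.Ext X Y n

/-- (T2): `Ext^i(T, T) = 0` for all `i > 0`. -/
def SelfOrthogonal (T : ModuleCat.{u} B) : Prop :=
  ∀ i : ℕ, 0 < i → Subsingleton (ExtGroup T T i)

/-- Pre-tilting: (T1) and (T2). -/
def IsPreTilting (T : ModuleCat.{u} B) : Prop :=
  HasFiniteProjDim T ∧ SelfOrthogonal T

/-- Tilting: (T1), (T2) and (T3) (an `add T`-coresolution of the regular module). -/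
def IsTilting (T : ModuleCat.{u} B) : Prop :=
  HasFiniteProjDim T ∧ SelfOrthogonal T ∧ ∃ d, CoresolvedBy T (ModuleCat.of B B) d

/-- The direct sum `M ⊕ N`. -/
def dSum (M N : ModuleCat.{u} B) : ModuleCat.{u} B := ModuleCat.of B (M × N)

/-- `N` is an (indecomposable) complement to `M`: a finite-dimensional indecomposable module
not in `add M` such that `M ⊕ N` is a tilting module. -/
def IsComplement (M N : ModuleCat.{u} B) : Prop :=
  Module.Finite B N ∧ IsIndec N ∧ ¬ MemAdd M N ∧ IsTilting (dSum M N)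

end Modules

namespace TiltingComplements

open Abelian

section ExtToolkit

instance hasExtModuleCat (B : Type u) [Ring B] : HasExt.{u + 1} (ModuleCat.{u} B) :=
  letI : HasDerivedCategory.{u + 1} (ModuleCat.{u} B) := HasDerivedCategory.standard _
  hasExt_of_hasDerivedCategory _

variable (B : Type u) [Ring B]

/-- Vanishing of `Ext^i_B(X, Y)`. -/
def ExtVanish (X Y : Type u) [AddCommGroup X] [Module B X] [AddCommGroup Y] [Module B Y]
    (i : ℕ) : Prop :=
  Subsingleton (Ext.{u + 1} (ModuleCat.of B X) (ModuleCat.of B Y) i)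

variable {B}

variable {X Y Z K E W : Type u} [AddCommGroup X] [Module B X] [AddCommGroup Y] [Module B Y]
  [AddCommGroup Z] [Module B Z] [AddCommGroup K] [Module B K] [AddCommGroup E] [Module B E]
  [AddCommGroup W] [Module B W]

/-- A short exact sequence `0 → K → E → Y → 0` of modules. -/
structure IsShortExact (f : K →ₗ[B] E) (g : E →ₗ[B] Y) : Prop where
  inj : Function.Injective f
  exact : Function.Exact f g
  surj : Function.Surjective g

namespace IsShortExact

variable {f : K →ₗ[B] E} {g : E →ₗ[B] Y}

lemma comp_eq_zero (h : IsShortExact f g) : g.comp f = 0 := by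
  ext x; exact h.exact.apply_apply_eq_zero x

/-- The associated short complex in the category of modules. -/
@[reducible] def complex (h : IsShortExact f g) : ShortComplex (ModuleCat.{u} B) :=
  ShortComplex.mk (ModuleCat.ofHom f) (ModuleCat.ofHom g) (by
    rw [← ModuleCat.ofHom_comp, h.comp_eq_zero]; rfl)

lemma shortExact (h : IsShortExact f g) : h.complex.ShortExact :=
  ModuleCat.shortComplex_shortExact h.complex h.exact h.inj h.surj

lemma extVanish_left (h : IsShortExact f g) {i : ℕ} (h₁ : ExtVanish B X Y i)
    (h₂ : ExtVanish B X E (i + 1)) : ExtVanish B X K (i + 1) := by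
  refine subsingleton_of_forall_eq 0 fun x => ?_
  obtain ⟨y, rfl⟩ := Ext.covariant_sequence_exact₁ (ModuleCat.of B X) h.shortExact x
    (h₂.elim _ _) rfl
  rw [h₁.elim y 0, Ext.zero_comp]

lemma extVanish_middle (h : IsShortExact f g) {i : ℕ} (h₁ : ExtVanish B X K i)
    (h₂ : ExtVanish B X Y i) : ExtVanish B X E i := by
  refine subsingleton_of_forall_eq 0 fun x => ?_
  obtain ⟨y, rfl⟩ := Ext.covariant_sequence_exact₂ (ModuleCat.of B X) h.shortExact x
    (h₂.elim _ _)
  rw [h₁.elim y 0, Ext.zero_comp]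

lemma extVanish_right (h : IsShortExact f g) {i : ℕ} (h₁ : ExtVanish B X E i)
    (h₂ : ExtVanish B X K (i + 1)) : ExtVanish B X Y i := by
  refine subsingleton_of_forall_eq 0 fun x => ?_
  obtain ⟨y, rfl⟩ := Ext.covariant_sequence_exact₃ (ModuleCat.of B X) h.shortExact x rfl
    (h₂.elim _ _)
  rw [h₁.elim y 0, Ext.zero_comp]

lemma extVanish_right' (h : IsShortExact f g) {i : ℕ} (h₁ : ExtVanish B K W i)
    (h₂ : ExtVanish B E W (i + 1)) : ExtVanish B Y W (i + 1) := by
  refine subsingleton_of_forall_eq 0 fun x => ?_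
  obtain ⟨y, rfl⟩ := Ext.contravariant_sequence_exact₃ h.shortExact (ModuleCat.of B W) x
    (h₂.elim _ _) (Nat.add_comm 1 i)
  rw [h₁.elim y 0, Ext.comp_zero]

lemma extVanish_middle' (h : IsShortExact f g) {i : ℕ} (h₁ : ExtVanish B K W i)
    (h₂ : ExtVanish B Y W i) : ExtVanish B E W i := by
  refine subsingleton_of_forall_eq 0 fun x => ?_
  obtain ⟨y, rfl⟩ := Ext.contravariant_sequence_exact₂ h.shortExact (ModuleCat.of B W) x
    (h₁.elim _ _)
  rw [h₂.elim y 0, Ext.comp_zero]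

lemma extVanish_left' (h : IsShortExact f g) {i : ℕ} (h₁ : ExtVanish B E W i)
    (h₂ : ExtVanish B Y W (i + 1)) : ExtVanish B K W i := by
  refine subsingleton_of_forall_eq 0 fun x => ?_
  obtain ⟨y, rfl⟩ := Ext.contravariant_sequence_exact₁ h.shortExact (ModuleCat.of B W) x
    (Nat.add_comm 1 i) (h₂.elim _ _)
  rw [h₁.elim y 0, Ext.comp_zero]

lemma exists_lift (h : IsShortExact f g) (hV : ExtVanish B X K 1) (p : X →ₗ[B] Y) :
    ∃ q : X →ₗ[B] E, g.comp q = p := by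
  obtain ⟨y, hy⟩ := Ext.covariant_sequence_exact₃ (ModuleCat.of B X) h.shortExact
    (Ext.mk₀ (ModuleCat.ofHom p)) (zero_add 1) (hV.elim _ _)
  obtain ⟨q, rfl⟩ := (Ext.mk₀_bijective _ _).2 y
  rw [Ext.mk₀_comp_mk₀] at hy
  have := (Ext.mk₀_bijective _ _).1 hy
  exact ⟨q.hom, congrArg ModuleCat.Hom.hom this⟩

lemma exists_extend (h : IsShortExact f g) (hV : ExtVanish B Y W 1) (p : K →ₗ[B] W) :
    ∃ q : E →ₗ[B] W, q.comp f = p := by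
  obtain ⟨y, hy⟩ := Ext.contravariant_sequence_exact₁ h.shortExact (ModuleCat.of B W)
    (Ext.mk₀ (ModuleCat.ofHom p)) (Nat.add_zero 1) (hV.elim _ _)
  obtain ⟨q, rfl⟩ := (Ext.mk₀_bijective _ _).2 y
  rw [Ext.mk₀_comp_mk₀] at hy
  have := (Ext.mk₀_bijective _ _).1 hy
  exact ⟨q.hom, congrArg ModuleCat.Hom.hom this⟩

lemma extVanish_one_left (h : IsShortExact f g) (hV : ExtVanish B X E 1)
    (hl : ∀ p : X →ₗ[B] Y, ∃ q : X →ₗ[B] E, g.comp q = p) : ExtVanish B X K 1 := by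
  refine subsingleton_of_forall_eq 0 fun x => ?_
  obtain ⟨y, rfl⟩ := Ext.covariant_sequence_exact₁ (ModuleCat.of B X) h.shortExact x
    (hV.elim _ _) (zero_add 1)
  obtain ⟨p, rfl⟩ := (Ext.mk₀_bijective _ _).2 y
  obtain ⟨q, hq⟩ := hl p.hom
  have : p = ModuleCat.ofHom q ≫ h.complex.g := by
    ext x; exact (LinearMap.congr_fun hq x).symm
  rw [this, ← Ext.mk₀_comp_mk₀_assoc, h.shortExact.comp_extClass, Ext.comp_zero]

end IsShortExact

lemma isShortExact_ker (g : E →ₗ[B] Y) (hg : Function.Surjective g) :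
    IsShortExact (LinearMap.ker g).subtype g :=
  ⟨Subtype.val_injective, LinearMap.exact_subtype_ker_map g, hg⟩

lemma isShortExact_mkQ (f : K →ₗ[B] E) (hf : Function.Injective f) :
    IsShortExact f (LinearMap.range f).mkQ :=
  ⟨hf, LinearMap.exact_map_mkQ_range f, Submodule.mkQ_surjective _⟩

lemma mk₀_finsetSum {X Y : ModuleCat.{u} B} {ι : Type*} (s : Finset ι) (f : ι → (X ⟶ Y)) :
    Ext.mk₀ (∑ j ∈ s, f j) = ∑ j ∈ s, Ext.mk₀ (f j) :=
  map_sum (Ext.addEquiv₀ (X := X) (Y := Y)).symm f s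

lemma finsetSum_comp {X Y Z : ModuleCat.{u} B} {ι : Type*} (s : Finset ι) {p q n : ℕ}
    (x : ι → Ext.{u + 1} X Y p) (y : Ext.{u + 1} Y Z q) (h : p + q = n) :
    (∑ j ∈ s, x j).comp y h = ∑ j ∈ s, (x j).comp y h :=
  map_sum (AddMonoidHom.mk' (fun x => Ext.comp x y h) fun _ _ => Ext.add_comp _ _ _ _) x s

lemma comp_finsetSum {X Y Z : ModuleCat.{u} B} {ι : Type*} (s : Finset ι) {p q n : ℕ}
    (x : Ext.{u + 1} X Y p) (y : ι → Ext.{u + 1} Y Z q) (h : p + q = n) :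
    x.comp (∑ j ∈ s, y j) h = ∑ j ∈ s, x.comp (y j) h :=
  map_sum (AddMonoidHom.mk' (fun y => Ext.comp x y h) fun _ _ => Ext.comp_add _ _ _ _) y s

lemma extVanish_sum_left {ι : Type*} {T : ι → Type u} [∀ j, AddCommGroup (T j)]
    [∀ j, Module B (T j)] (s : Finset ι) (f : ∀ j, X →ₗ[B] T j) (g : ∀ j, T j →ₗ[B] X)
    (h : ∑ j ∈ s, (g j).comp (f j) = LinearMap.id) {i : ℕ}
    (hV : ∀ j ∈ s, ExtVanish B (T j) Y i) : ExtVanish B X Y i := by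
  refine subsingleton_of_forall_eq 0 fun x => ?_
  have h' : 𝟙 (ModuleCat.of B X) = ∑ j ∈ s, ModuleCat.ofHom (f j) ≫ ModuleCat.ofHom (g j) := by
    apply ModuleCat.hom_ext
    rw [ModuleCat.hom_sum, ModuleCat.hom_id, ← h]
    rfl
  rw [← Ext.mk₀_id_comp x, h', mk₀_finsetSum, finsetSum_comp]
  refine Finset.sum_eq_zero fun j hj => ?_
  rw [← Ext.mk₀_comp_mk₀_assoc, (hV j hj).elim ((Ext.mk₀ (ModuleCat.ofHom (g j))).comp x _) 0,
    Ext.comp_zero]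

lemma extVanish_sum_right {ι : Type*} {T : ι → Type u} [∀ j, AddCommGroup (T j)]
    [∀ j, Module B (T j)] (s : Finset ι) (f : ∀ j, Y →ₗ[B] T j) (g : ∀ j, T j →ₗ[B] Y)
    (h : ∑ j ∈ s, (g j).comp (f j) = LinearMap.id) {i : ℕ}
    (hV : ∀ j ∈ s, ExtVanish B X (T j) i) : ExtVanish B X Y i := by
  refine subsingleton_of_forall_eq 0 fun x => ?_
  have h' : 𝟙 (ModuleCat.of B Y) = ∑ j ∈ s, ModuleCat.ofHom (f j) ≫ ModuleCat.ofHom (g j) := by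
    apply ModuleCat.hom_ext
    rw [ModuleCat.hom_sum, ModuleCat.hom_id, ← h]
    rfl
  rw [← Ext.comp_mk₀_id x, h', mk₀_finsetSum, comp_finsetSum]
  refine Finset.sum_eq_zero fun j hj => ?_
  rw [← Ext.mk₀_comp_mk₀, ← Ext.comp_assoc_of_second_deg_zero,
    (hV j hj).elim (x.comp (Ext.mk₀ (ModuleCat.ofHom (f j))) _) 0, Ext.zero_comp]

lemma extVanish_retract_left (f : X →ₗ[B] Z) (g : Z →ₗ[B] X) (h : g.comp f = LinearMap.id)
    {i : ℕ} (hV : ExtVanish B Z Y i) : ExtVanish B X Y i :=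
  extVanish_sum_left (T := fun _ : Unit => Z) Finset.univ (fun _ => f) (fun _ => g)
    (by simpa using h) fun _ _ => hV

lemma extVanish_retract_right (f : Y →ₗ[B] Z) (g : Z →ₗ[B] Y) (h : g.comp f = LinearMap.id)
    {i : ℕ} (hV : ExtVanish B X Z i) : ExtVanish B X Y i :=
  extVanish_sum_right (T := fun _ : Unit => Z) Finset.univ (fun _ => f) (fun _ => g)
    (by simpa using h) fun _ _ => hV

lemma extVanish_pi_right {ι : Type} [Fintype ι] {T : ι → Type u} [∀ j, AddCommGroup (T j)]
    [∀ j, Module B (T j)] {i : ℕ} (hV : ∀ j, ExtVanish B X (T j) i) :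
    ExtVanish B X (∀ j, T j) i := by
  classical
  refine extVanish_sum_right (T := T) Finset.univ (fun j => LinearMap.proj j)
    (fun j => LinearMap.single B T j) ?_ fun j _ => hV j
  refine LinearMap.ext fun v => ?_
  simpa using LinearMap.sum_single_apply T v

lemma extVanish_pi_left {ι : Type} [Fintype ι] {T : ι → Type u} [∀ j, AddCommGroup (T j)]
    [∀ j, Module B (T j)] {i : ℕ} (hV : ∀ j, ExtVanish B (T j) X i) :
    ExtVanish B (∀ j, T j) X i := by
  classical
  refine extVanish_sum_left (T := T) Finset.univ (fun j => LinearMap.proj j)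
    (fun j => LinearMap.single B T j) ?_ fun j _ => hV j
  refine LinearMap.ext fun v => ?_
  simpa using LinearMap.sum_single_apply T v

lemma extVanish_prod_right {i : ℕ} (hY : ExtVanish B X Y i) (hZ : ExtVanish B X Z i) :
    ExtVanish B X (Y × Z) i :=
  IsShortExact.extVanish_middle (f := LinearMap.inl B Y Z) (g := LinearMap.snd B Y Z)
    ⟨LinearMap.inl_injective, .inl_snd, LinearMap.snd_surjective⟩ hY hZ

lemma extVanish_prod_left {i : ℕ} (hY : ExtVanish B Y X i) (hZ : ExtVanish B Z X i) :
    ExtVanish B (Y × Z) X i :=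
  IsShortExact.extVanish_middle' (f := LinearMap.inl B Y Z) (g := LinearMap.snd B Y Z)
    ⟨LinearMap.inl_injective, .inl_snd, LinearMap.snd_surjective⟩ hY hZ

lemma extVanish_of_projective [Module.Projective B X] (i : ℕ) : ExtVanish B X Y (i + 1) := by
  have : Projective (ModuleCat.of B X) := (IsProjective.iff_projective X).1 inferInstance
  exact Ext.subsingleton_of_projective _ _ _

lemma extVanish_of_injective [Module.Injective B Y] (i : ℕ) : ExtVanish B X Y (i + 1) := by
  have : Injective (ModuleCat.of B Y) := Module.injective_object_of_injective_module B Y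
  exact Ext.subsingleton_of_injective _ _ _

lemma ExtVanish.of_subsingleton [Subsingleton Y] (i : ℕ) : ExtVanish B X Y i := by
  have := extVanish_pi_right (B := B) (X := X) (ι := Empty) (T := fun _ => X) (i := i)
    (fun j => j.elim)
  exact extVanish_retract_right (Z := Empty → X) 0 0 (LinearMap.ext fun _ => Subsingleton.elim _ _)
    this

/-- All Ext groups out of `X` vanish in large degrees. -/
def FPD (B : Type u) [Ring B] (X : Type u) [AddCommGroup X] [Module B X] : Prop :=
  ∃ d : ℕ, ∀ i : ℕ, d < i → ∀ (W : Type u) [AddCommGroup W] [Module B W], ExtVanish B X W i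

lemma extVanish_of_projDimLE (d : ℕ) : ∀ (X : ModuleCat.{u} B), ProjDimLE X d →
    ∀ i : ℕ, d < i → ∀ (W : Type u) [AddCommGroup W] [Module B W], ExtVanish B X W i := by
  induction d with
  | zero =>
    intro X hX i hi W _ _
    obtain ⟨j, rfl⟩ : ∃ j, i = j + 1 := ⟨i - 1, by omega⟩
    have : Module.Projective B X := hX
    exact extVanish_of_projective j
  | succ d ih =>
    rintro X ⟨P, hP, f, hf, hK⟩ i hi W _ _
    obtain ⟨j, rfl⟩ : ∃ j, i = j + 1 := ⟨i - 1, by omega⟩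
    exact (isShortExact_ker f hf).extVanish_right' (ih _ hK j (by omega) W)
      (extVanish_of_projective j)

lemma FPD.of_hasFiniteProjDim {X : ModuleCat.{u} B} (h : HasFiniteProjDim X) : FPD B X := by
  obtain ⟨d, hd⟩ := h
  exact ⟨d, extVanish_of_projDimLE d X hd⟩

lemma FPD.retract (h : FPD B Z) (f : X →ₗ[B] Z) (g : Z →ₗ[B] X)
    (hgf : g.comp f = LinearMap.id) : FPD B X := by
  obtain ⟨d, hd⟩ := h
  exact ⟨d, fun i hi W _ _ => extVanish_retract_left f g hgf (hd i hi W)⟩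

end ExtToolkit

end TiltingComplements

namespace TiltingComplements

open Abelian

section Factoring

variable {B : Type u} [Ring B]
variable {X Y Z T S W : Type u} [AddCommGroup X] [Module B X] [AddCommGroup Y] [Module B Y]
  [AddCommGroup Z] [Module B Z] [AddCommGroup T] [Module B T] [AddCommGroup S] [Module B S]
  [AddCommGroup W] [Module B W]

/-- The map `f` is a finite sum of maps factoring through `T`. -/
def Fac (T : Type u) [AddCommGroup T] [Module B T] (f : X →ₗ[B] Y) : Prop :=
  f ∈ Submodule.span ℤ {f : X →ₗ[B] Y | ∃ (a : X →ₗ[B] T) (b : T →ₗ[B] Y), b.comp a = f}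

lemma fac_comp (b : T →ₗ[B] Y) (a : X →ₗ[B] T) : Fac T (b.comp a) :=
  Submodule.subset_span ⟨a, b, rfl⟩

lemma Fac.zero : Fac T (0 : X →ₗ[B] Y) := Submodule.zero_mem _

lemma Fac.add {f g : X →ₗ[B] Y} (hf : Fac T f) (hg : Fac T g) : Fac T (f + g) :=
  Submodule.add_mem _ hf hg

lemma Fac.neg {f : X →ₗ[B] Y} (hf : Fac T f) : Fac T (-f) :=
  Submodule.neg_mem _ hf

lemma Fac.sum {ι : Type*} (s : Finset ι) {f : ι → (X →ₗ[B] Y)} (h : ∀ i ∈ s, Fac T (f i)) :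
    Fac T (∑ i ∈ s, f i) :=
  Submodule.sum_mem _ h

lemma Fac.comp_left {f : X →ₗ[B] Y} (hf : Fac T f) (g : Y →ₗ[B] Z) : Fac T (g.comp f) := by
  refine Submodule.span_induction (p := fun f _ => Fac T (g.comp f)) ?_ ?_ ?_ ?_ hf
  · rintro _ ⟨a, b, rfl⟩
    exact fac_comp (g.comp b) a
  · rw [LinearMap.comp_zero]; exact .zero
  · intro x y _ _ hx hy
    rw [LinearMap.comp_add]; exact hx.add hy
  · intro n x _ hx
    rw [LinearMap.comp_smul]; exact Submodule.smul_mem _ _ hx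

lemma Fac.comp_right {f : Y →ₗ[B] Z} (hf : Fac T f) (g : X →ₗ[B] Y) : Fac T (f.comp g) := by
  refine Submodule.span_induction (p := fun f _ => Fac T (f.comp g)) ?_ ?_ ?_ ?_ hf
  · rintro _ ⟨a, b, rfl⟩
    exact fac_comp b (a.comp g)
  · rw [LinearMap.zero_comp]; exact .zero
  · intro x y _ _ hx hy
    rw [LinearMap.add_comp]; exact hx.add hy
  · intro n x _ hx
    rw [LinearMap.smul_comp]; exact Submodule.smul_mem _ _ hx

lemma Fac.exists_sum {f : X →ₗ[B] Y} (hf : Fac T f) :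
    ∃ (n : ℕ) (a : Fin n → (X →ₗ[B] T)) (b : Fin n → (T →ₗ[B] Y)),
      ∑ i, (b i).comp (a i) = f := by
  obtain ⟨n, c, g, h⟩ := Submodule.mem_span_set'.1 hf
  choose a b hab using fun i => (g i).2
  refine ⟨n, a, fun i => c i • b i, ?_⟩
  rw [← h]
  refine Finset.sum_congr rfl fun i _ => ?_
  rw [LinearMap.smul_comp, hab]

lemma sum_single_comp_proj (n : ℕ) :
    ∑ i : Fin n, (LinearMap.single B (fun _ => T) i).comp (LinearMap.proj i) =
      (LinearMap.id : (Fin n → T) →ₗ[B] (Fin n → T)) := by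
  refine LinearMap.ext fun v => ?_
  simpa using LinearMap.sum_single_apply (fun _ => T) v

lemma fac_pi (n : ℕ) : Fac T (LinearMap.id : (Fin n → T) →ₗ[B] (Fin n → T)) := by
  rw [← sum_single_comp_proj n]
  exact Fac.sum _ fun i _ => fac_comp _ _

lemma Fac.of_comp_id (h : Fac T (LinearMap.id : S →ₗ[B] S)) (b : S →ₗ[B] Y) (a : X →ₗ[B] S) :
    Fac T (b.comp a) := by
  have := (h.comp_right a).comp_left b
  rwa [LinearMap.id_comp] at this

lemma fac_comp_pi {n : ℕ} (b : (Fin n → T) →ₗ[B] Y) (a : X →ₗ[B] (Fin n → T)) :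
    Fac T (b.comp a) :=
  (fac_pi n).of_comp_id b a

lemma Fac.exists_pi {f : X →ₗ[B] Y} (hf : Fac T f) :
    ∃ (n : ℕ) (a : X →ₗ[B] (Fin n → T)) (b : (Fin n → T) →ₗ[B] Y), b.comp a = f := by
  obtain ⟨n, a, b, rfl⟩ := hf.exists_sum
  refine ⟨n, LinearMap.pi a, ∑ i, (b i).comp (LinearMap.proj i), ?_⟩
  ext x
  simp

lemma memAdd_iff_fac (M Y : ModuleCat.{u} B) :
    MemAdd M Y ↔ Fac (B := B) M (LinearMap.id : Y →ₗ[B] Y) := by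
  constructor
  · rintro ⟨n, f, g, h⟩
    rw [← h]
    exact fac_comp_pi g f
  · intro h
    obtain ⟨n, a, b, h⟩ := h.exists_pi
    exact ⟨n, a, b, h⟩

lemma extVanish_of_fac_left (h : Fac T (LinearMap.id : X →ₗ[B] X)) {i : ℕ}
    (hV : ExtVanish B T Y i) : ExtVanish B X Y i := by
  obtain ⟨n, a, b, h⟩ := h.exists_pi
  exact extVanish_retract_left a b h (extVanish_pi_left fun _ => hV)

lemma extVanish_of_fac_right (h : Fac T (LinearMap.id : Y →ₗ[B] Y)) {i : ℕ}
    (hV : ExtVanish B X T i) : ExtVanish B X Y i := by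
  obtain ⟨n, a, b, h⟩ := h.exists_pi
  exact extVanish_retract_right a b h (extVanish_pi_right fun _ => hV)

variable (B) in
/-- The trace of `T` in `Z`. -/
def trace (T Z : Type u) [AddCommGroup T] [Module B T] [AddCommGroup Z] [Module B Z] :
    Submodule B Z :=
  ⨆ f : T →ₗ[B] Z, LinearMap.range f

lemma range_le_trace (f : T →ₗ[B] Z) : LinearMap.range f ≤ trace B T Z :=
  le_iSup (fun f : T →ₗ[B] Z => LinearMap.range f) f

lemma Fac.range_le_trace {f : X →ₗ[B] Z} (hf : Fac T f) : LinearMap.range f ≤ trace B T Z := by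
  obtain ⟨n, a, b, rfl⟩ := hf.exists_sum
  rintro _ ⟨x, rfl⟩
  rw [LinearMap.sum_apply]
  exact Submodule.sum_mem _ fun i _ => TiltingComplements.range_le_trace (b i) ⟨a i x, rfl⟩

lemma map_trace_le (g : Z →ₗ[B] W) : (trace B T Z).map g ≤ trace B T W := by
  rw [trace, Submodule.map_iSup]
  refine iSup_le fun f => ?_
  rw [← LinearMap.range_comp]
  exact TiltingComplements.range_le_trace _

lemma trace_le_trace_of_eq_top (h : trace B T S = ⊤) : trace B S Z ≤ trace B T Z := by
  refine iSup_le fun f => ?_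
  rw [← Submodule.map_top, ← h]
  exact map_trace_le f

lemma exists_mem_trace {z : Z} (hz : z ∈ trace B T Z) :
    ∃ (n : ℕ) (f : (Fin n → T) →ₗ[B] Z), z ∈ LinearMap.range f := by
  refine Submodule.iSup_induction _ (motive := fun z =>
    ∃ (n : ℕ) (f : (Fin n → T) →ₗ[B] Z), z ∈ LinearMap.range f) hz ?_ ?_ ?_
  · rintro f _ ⟨x, rfl⟩
    exact ⟨1, f.comp (LinearMap.proj 0), fun _ => x, rfl⟩
  · exact ⟨0, 0, 0, rfl⟩
  · rintro _ _ ⟨n, f, x, rfl⟩ ⟨m, g, y, rfl⟩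
    refine ⟨n + m, f.comp (LinearMap.funLeft B T (Fin.castAdd m)) +
      g.comp (LinearMap.funLeft B T (Fin.natAdd n)), Fin.append x y, ?_⟩
    simp only [LinearMap.add_apply, LinearMap.comp_apply]
    congr 2 <;> ext i <;> simp [LinearMap.funLeft_apply]

end Factoring

section Scalars

variable (k : Type u) [Field k] {B : Type u} [Ring B] [Algebra k B]
variable {X Y : Type u} [AddCommGroup X] [Module B X] [AddCommGroup Y] [Module B Y]

variable (B X) in
/-- Multiplication by a scalar of the ground field as a `B`-linear endomorphism. -/
def scalarEnd (c : k) : X →ₗ[B] X where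
  toFun x := algebraMap k B c • x
  map_add' := smul_add _
  map_smul' b x := by
    simp only [RingHom.id_apply, ← mul_smul, Algebra.commutes]

lemma scalarEnd_comm (c : k) (f : X →ₗ[B] Y) :
    f.comp (scalarEnd k B X c) = (scalarEnd k B Y c).comp f := by
  ext x; exact f.map_smul _ _

variable [Module.Finite k B]

lemma exists_hom_generators (X Y : Type u) [AddCommGroup X] [Module B X] [AddCommGroup Y]
    [Module B Y] [Module.Finite B X] [Module.Finite B Y] :
    ∃ (s : ℕ) (f : Fin s → (X →ₗ[B] Y)), ∀ g : X →ₗ[B] Y, ∃ c : Fin s → k,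
      g = ∑ i, (f i).comp (scalarEnd k B X (c i)) := by
  let _ : Module k X := Module.compHom X (algebraMap k B)
  let _ : Module k Y := Module.compHom Y (algebraMap k B)
  have hX : IsScalarTower k B X := ⟨fun c b x => by
    rw [Algebra.smul_def, mul_smul]; rfl⟩
  have hY : IsScalarTower k B Y := ⟨fun c b x => by
    rw [Algebra.smul_def, mul_smul]; rfl⟩
  have : SMulCommClass B k Y := ⟨fun b c x => by
    change b • (algebraMap k B c • x) = algebraMap k B c • (b • x)
    rw [← mul_smul, ← mul_smul, Algebra.commutes]⟩
  have : Module.Finite k X := Module.Finite.trans B X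
  have : Module.Finite k Y := Module.Finite.trans B Y
  have : Module.Finite k (X →ₗ[B] Y) :=
    Module.Finite.of_injective (LinearMap.restrictScalarsₗ k B X Y k)
      (LinearMap.restrictScalars_injective k)
  obtain ⟨s, f, hf⟩ := Module.Finite.exists_fin (R := k) (M := X →ₗ[B] Y)
  refine ⟨s, f, fun g => ?_⟩
  have hg : g ∈ Submodule.span k (Set.range f) := hf ▸ Submodule.mem_top
  obtain ⟨c, rfl⟩ := (Submodule.mem_span_range_iff_exists_fun k).1 hg
  refine ⟨c, Finset.sum_congr rfl fun i _ => ?_⟩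
  ext x
  exact ((f i).map_smul (algebraMap k B (c i)) x).symm

end Scalars

lemma exists_approx (k : Type u) [Field k] {B : Type u} [Ring B] [Algebra k B]
    [Module.Finite k B] (T Z : Type u) [AddCommGroup T] [Module B T] [AddCommGroup Z]
    [Module B Z] [Module.Finite B T] [Module.Finite B Z] :
    ∃ (a : ℕ) (g : (Fin a → T) →ₗ[B] Z), LinearMap.range g = trace B T Z ∧
      ∀ f : T →ₗ[B] Z, ∃ c : T →ₗ[B] (Fin a → T), g.comp c = f := by
  obtain ⟨s, f, hf⟩ := exists_hom_generators k (B := B) T Z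
  have key : ∀ h : T →ₗ[B] Z, ∃ c : T →ₗ[B] (Fin s → T),
      (∑ i, (f i).comp (LinearMap.proj i)).comp c = h := by
    intro h
    obtain ⟨c, rfl⟩ := hf h
    refine ⟨LinearMap.pi fun i => scalarEnd k B T (c i), ?_⟩
    ext x
    simp
  refine ⟨s, ∑ i, (f i).comp (LinearMap.proj i), le_antisymm ?_ (iSup_le fun h => ?_), key⟩
  · exact Fac.range_le_trace (Fac.sum _ fun i _ => fac_comp _ _)
  · obtain ⟨c, rfl⟩ := key h
    exact LinearMap.range_comp_le_range _ _

lemma Fac.lift_approx {B : Type u} [Ring B] {X Z T E : Type u} [AddCommGroup X] [Module B X]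
    [AddCommGroup Z] [Module B Z] [AddCommGroup T] [Module B T] [AddCommGroup E] [Module B E]
    {g : E →ₗ[B] Z} (hg : ∀ f : T →ₗ[B] Z, ∃ c : T →ₗ[B] E, g.comp c = f)
    {f : X →ₗ[B] Z} (hf : Fac T f) : ∃ c : X →ₗ[B] E, g.comp c = f := by
  obtain ⟨n, a, b, rfl⟩ := hf.exists_sum
  choose c hc using hg
  refine ⟨∑ i, (c (b i)).comp (a i), ?_⟩
  ext x
  simp only [LinearMap.comp_apply, LinearMap.sum_apply, map_sum]
  exact Finset.sum_congr rfl fun i _ => LinearMap.congr_fun (hc (b i)) _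

section Extensions

variable {B : Type u} [Ring B]
variable {X Y Z K E W : Type u} [AddCommGroup X] [Module B X] [AddCommGroup Y] [Module B Y]
  [AddCommGroup Z] [Module B Z] [AddCommGroup K] [Module B K] [AddCommGroup E] [Module B E]
  [AddCommGroup W] [Module B W]

/-- Naturality of the extension class with respect to morphisms of short exact sequences. -/
lemma IsShortExact.extClass_naturality {f : K →ₗ[B] E} {g : E →ₗ[B] Y} (h : IsShortExact f g)
    {K' E' Y' : Type u} [AddCommGroup K'] [Module B K'] [AddCommGroup E'] [Module B E']
    [AddCommGroup Y'] [Module B Y'] {f' : K' →ₗ[B] E'} {g' : E' →ₗ[B] Y'}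
    (h' : IsShortExact f' g') (a : K →ₗ[B] K') (b : E →ₗ[B] E') (c : Y →ₗ[B] Y')
    (hab : b.comp f = f'.comp a) (hbc : c.comp g = g'.comp b) :
    h.shortExact.extClass.comp (Ext.mk₀ (ModuleCat.ofHom a)) (add_zero 1) =
      (Ext.mk₀ (ModuleCat.ofHom c)).comp h'.shortExact.extClass (zero_add 1) :=
  ShortComplex.ShortExact.extClass_naturality h.shortExact h'.shortExact
    { τ₁ := ModuleCat.ofHom a
      τ₂ := ModuleCat.ofHom b
      τ₃ := ModuleCat.ofHom c
      comm₁₂ := by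
        apply ModuleCat.hom_ext; exact hab.symm
      comm₂₃ := by
        apply ModuleCat.hom_ext; exact hbc.symm }

/-- Pushout of a short exact sequence along a map of the kernel. -/
lemma IsShortExact.exists_pushout {f : K →ₗ[B] E} {g : E →ₗ[B] Y} (h : IsShortExact f g)
    [Module.Finite B E] [Module.Finite B Z] (a : K →ₗ[B] Z) :
    ∃ (F : Type u) (_ : AddCommGroup F) (_ : Module B F) (_ : Module.Finite B F)
      (i : Z →ₗ[B] F) (p : F →ₗ[B] Y) (b : E →ₗ[B] F),
      IsShortExact i p ∧ b.comp f = i.comp a ∧ g = p.comp b := by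
  let N : Submodule B (Z × E) := LinearMap.range (a.prod (-f))
  have hN : N ≤ LinearMap.ker (g.comp (LinearMap.snd B Z E)) := by
    rintro _ ⟨x, rfl⟩
    simp [h.exact.apply_apply_eq_zero]
  refine ⟨(Z × E) ⧸ N, inferInstance, inferInstance, inferInstance,
    N.mkQ.comp (LinearMap.inl B Z E), N.liftQ (g.comp (LinearMap.snd B Z E)) hN,
    N.mkQ.comp (LinearMap.inr B Z E), ⟨?_, ?_, ?_⟩, ?_, ?_⟩
  · rw [← LinearMap.ker_eq_bot, LinearMap.ker_eq_bot']
    intro z hz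
    have : (z, (0 : E)) ∈ N := (Submodule.Quotient.mk_eq_zero N).1 hz
    obtain ⟨x, hx⟩ := this
    have h1 : a x = z := congrArg Prod.fst hx
    have h2 : -f x = 0 := congrArg Prod.snd hx
    have : x = 0 := h.inj (by rw [map_zero]; exact neg_eq_zero.1 h2)
    rw [← h1, this, map_zero]
  · intro x
    constructor
    · induction x using Submodule.Quotient.induction_on with | _ x => ?_
      obtain ⟨z, e⟩ := x
      intro hx
      have hx' : g e = 0 := hx
      obtain ⟨y, rfl⟩ := (h.exact e).1 hx'
      refine ⟨z + a y, ?_⟩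
      refine (Submodule.Quotient.eq N).2 ⟨y, ?_⟩
      simp
    · rintro ⟨z, rfl⟩
      simp
  · intro y
    obtain ⟨e, rfl⟩ := h.surj y
    exact ⟨N.mkQ (0, e), by simp⟩
  · ext x
    refine (Submodule.Quotient.eq N).2 ⟨-x, ?_⟩
    simp
  · ext x; simp

variable (B X) in
/-- A presentation of a finitely generated module by a finite free module. -/
lemma exists_free_presentation [Module.Finite B X] :
    ∃ (s : ℕ) (g : (Fin s → B) →ₗ[B] X), Function.Surjective g := by
  obtain ⟨s, g, hg⟩ := Module.Finite.exists_fin' B X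
  exact ⟨s, g, hg⟩

lemma IsShortExact.exists_eq_extClass_comp {f : K →ₗ[B] E} {g : E →ₗ[B] Y}
    (h : IsShortExact f g) [Module.Projective B E]
    (ξ : Ext.{u + 1} (ModuleCat.of B Y) (ModuleCat.of B Z) 1) :
    ∃ a : K →ₗ[B] Z, ξ = h.shortExact.extClass.comp (Ext.mk₀ (ModuleCat.ofHom a)) (add_zero 1) := by
  obtain ⟨y, hy⟩ := Ext.contravariant_sequence_exact₃ h.shortExact (ModuleCat.of B Z) ξ
    ((extVanish_of_projective (B := B) (X := E) (Y := Z) 0).elim _ _) (Nat.add_zero 1)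
  obtain ⟨a, rfl⟩ := (Ext.mk₀_bijective _ _).2 y
  exact ⟨a.hom, hy.symm⟩

/-- Every class in `Ext^1` is the class of an extension. -/
lemma exists_extension [Module.Finite B X] [Module.Finite B Z]
    (ξ : Ext.{u + 1} (ModuleCat.of B X) (ModuleCat.of B Z) 1) :
    ∃ (F : Type u) (_ : AddCommGroup F) (_ : Module B F) (_ : Module.Finite B F)
      (i : Z →ₗ[B] F) (p : F →ₗ[B] X) (h : IsShortExact i p), h.shortExact.extClass = ξ := by
  obtain ⟨s, g, hg⟩ := exists_free_presentation B X
  have hP := isShortExact_ker g hg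
  obtain ⟨a, rfl⟩ := hP.exists_eq_extClass_comp ξ
  obtain ⟨F, _, _, _, i, p, b, h, hab, hbc⟩ := hP.exists_pushout a
  refine ⟨F, inferInstance, inferInstance, inferInstance, i, p, h, ?_⟩
  have := hP.extClass_naturality h a b LinearMap.id hab (by rw [LinearMap.id_comp]; exact hbc)
  rw [this]
  exact (Ext.mk₀_id_comp _).symm

/-- Finite generation of `Ext^1(Y, Z)` over the endomorphism ring of `Y`. -/
lemma exists_ext_generators (k : Type u) [Field k] [Algebra k B] [Module.Finite k B]
    [IsNoetherianRing B] (Y Z : Type u) [AddCommGroup Y] [Module B Y] [AddCommGroup Z]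
    [Module B Z] [Module.Finite B Y] [Module.Finite B Z] :
    ∃ (s : ℕ) (ξ : Fin s → Ext.{u + 1} (ModuleCat.of B Y) (ModuleCat.of B Z) 1),
      ∀ η : Ext.{u + 1} (ModuleCat.of B Y) (ModuleCat.of B Z) 1, ∃ f : Fin s → (Y →ₗ[B] Y),
        η = ∑ i, (Ext.mk₀ (ModuleCat.ofHom (f i))).comp (ξ i) (zero_add 1) := by
  obtain ⟨n, g, hg⟩ := exists_free_presentation B Y
  have hP := isShortExact_ker g hg
  obtain ⟨s, h, hh⟩ := exists_hom_generators k (B := B) (LinearMap.ker g) Z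
  refine ⟨s, fun i => hP.shortExact.extClass.comp (Ext.mk₀ (ModuleCat.ofHom (h i)))
    (add_zero 1), fun η => ?_⟩
  obtain ⟨a, rfl⟩ := hP.exists_eq_extClass_comp η
  obtain ⟨c, rfl⟩ := hh a
  refine ⟨fun i => scalarEnd k B Y (c i), ?_⟩
  have : ModuleCat.ofHom (∑ i, (h i).comp (scalarEnd k B (LinearMap.ker g) (c i))) =
      ∑ i, ModuleCat.ofHom (scalarEnd k B (LinearMap.ker g) (c i)) ≫ ModuleCat.ofHom (h i) := by
    apply ModuleCat.hom_ext
    rw [ModuleCat.hom_sum]; rfl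
  rw [this, mk₀_finsetSum, comp_finsetSum]
  refine Finset.sum_congr rfl fun i _ => ?_
  rw [← Ext.mk₀_comp_mk₀, ← Ext.comp_assoc_of_second_deg_zero,
    hP.extClass_naturality hP (scalarEnd k B (LinearMap.ker g) (c i))
      (scalarEnd k B _ (c i)) (scalarEnd k B Y (c i)) (scalarEnd_comm k (c i) _).symm
      (scalarEnd_comm k (c i) _).symm]
  exact Ext.comp_assoc_of_third_deg_zero _ _ _ _

/-- The extension of a power of `Y` by `Z` determined by finitely many classes. -/
lemma exists_universal_extension [Module.Finite B Y] [Module.Finite B Z] (s : ℕ)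
    (ξ : Fin s → Ext.{u + 1} (ModuleCat.of B Y) (ModuleCat.of B Z) 1) :
    ∃ (F : Type u) (_ : AddCommGroup F) (_ : Module B F) (_ : Module.Finite B F)
      (i : Z →ₗ[B] F) (p : F →ₗ[B] (Fin s → Y)),
      IsShortExact i p ∧
      (∀ y : Y →ₗ[B] F, ∑ j, (Ext.mk₀ (ModuleCat.ofHom ((LinearMap.proj j).comp (p.comp y)))).comp
        (ξ j) (zero_add 1) = 0) ∧
      ((∀ η : Ext.{u + 1} (ModuleCat.of B Y) (ModuleCat.of B Z) 1, ∃ f : Fin s → (Y →ₗ[B] Y),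
        η = ∑ i, (Ext.mk₀ (ModuleCat.ofHom (f i))).comp (ξ i) (zero_add 1)) →
        ExtVanish B Y Y 1 → ExtVanish B Y F 1) := by
  let ε : Ext.{u + 1} (ModuleCat.of B (Fin s → Y)) (ModuleCat.of B Z) 1 :=
    ∑ j, (Ext.mk₀ (ModuleCat.ofHom (LinearMap.proj (R := B) (φ := fun _ : Fin s => Y) j))).comp
      (ξ j) (zero_add 1)
  have hε : ∀ y : Y →ₗ[B] (Fin s → Y), (Ext.mk₀ (ModuleCat.ofHom y)).comp ε (zero_add 1) =
      ∑ j, (Ext.mk₀ (ModuleCat.ofHom ((LinearMap.proj j).comp y))).comp (ξ j) (zero_add 1) := by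
    intro y
    rw [comp_finsetSum]
    refine Finset.sum_congr rfl fun j _ => ?_
    rw [Ext.mk₀_comp_mk₀_assoc]
    rfl
  obtain ⟨F, _, _, _, i, p, h, hF⟩ := exists_extension ε
  refine ⟨F, inferInstance, inferInstance, inferInstance, i, p, h, fun y => ?_, fun hgen hY => ?_⟩
  · rw [← hε, ← hF]
    have := h.shortExact.comp_extClass
    have h2 : ModuleCat.ofHom (p.comp y) = ModuleCat.ofHom y ≫ h.complex.g := rfl
    rw [h2, ← Ext.mk₀_comp_mk₀_assoc, this, Ext.comp_zero]
  · refine subsingleton_of_forall_eq 0 fun x => ?_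
    have hYs : ExtVanish B Y (Fin s → Y) 1 := extVanish_pi_right fun _ => hY
    obtain ⟨x', rfl⟩ := Ext.covariant_sequence_exact₂ (ModuleCat.of B Y) h.shortExact x
      (hYs.elim _ _)
    obtain ⟨f, hf⟩ := hgen x'
    have h3 : x' = (Ext.mk₀ (ModuleCat.ofHom (LinearMap.pi f))).comp ε (zero_add 1) := by
      rw [hε, hf]; rfl
    rw [h3, ← hF, Ext.comp_assoc_of_third_deg_zero, h.shortExact.extClass_comp, Ext.comp_zero]

end Extensions

end TiltingComplements

namespace TiltingComplements

open Abelian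

section Fitting

variable {B : Type u} [Ring B] {Y : Type u} [AddCommGroup Y] [Module B Y]

lemma exists_fitting [IsNoetherian B Y] [IsArtinian B Y] (f : Module.End B Y) :
    ∃ (n : ℕ) (e v : Module.End B Y), n ≠ 0 ∧ e * e = e ∧ e * f ^ n = f ^ n ∧
      v * f ^ n = e ∧ f ^ n * v = e := by
  obtain ⟨n, hn⟩ := (f.eventually_isCompl_ker_pow_range_pow.and
    (Filter.eventually_ne_atTop 0)).exists
  set g := f ^ n with hg
  let R := LinearMap.range g
  let r : R →ₗ[B] R := g.restrict fun x _ => LinearMap.mem_range_self g x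
  have hr : Function.Bijective r := by
    constructor
    · rw [← LinearMap.ker_eq_bot, LinearMap.ker_eq_bot']
      rintro ⟨x, hx⟩ h
      have h0 : g x = 0 := congrArg Subtype.val h
      have : x ∈ LinearMap.ker g ⊓ LinearMap.range g := ⟨h0, hx⟩
      rw [hn.1.inf_eq_bot] at this
      exact Subtype.ext this
    · rintro ⟨_, x, rfl⟩
      have : x ∈ LinearMap.ker g ⊔ LinearMap.range g := hn.1.sup_eq_top ▸ Submodule.mem_top
      obtain ⟨y, hy, z, hz, rfl⟩ := Submodule.mem_sup.1 this
      refine ⟨⟨z, hz⟩, Subtype.ext ?_⟩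
      change g z = g (y + z)
      rw [map_add, LinearMap.mem_ker.1 hy, zero_add]
  let re := LinearEquiv.ofBijective r hr
  let p : Y →ₗ[B] R := R.projectionOnto (LinearMap.ker g) hn.1.symm
  have hp : ∀ x : R, p x = x := fun x => Submodule.projectionOnto_apply_left _ _
  have hpk : ∀ x, g x = 0 → p x = 0 := fun x hx =>
    Submodule.projectionOnto_apply_of_mem_right hn.1.symm hx
  have hgp : ∀ x, g (p x) = g x := by
    intro x
    have : p (x - p x) = 0 := by rw [map_sub, hp, sub_self]
    have : x - p x ∈ LinearMap.ker p := this
    rw [Submodule.ker_projectionOnto] at this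
    have h2 : g (x - p x) = 0 := this
    rw [map_sub, sub_eq_zero] at h2
    exact h2.symm
  refine ⟨n, R.subtype.comp p, R.subtype.comp (re.symm.toLinearMap.comp p), hn.2, ?_, ?_, ?_, ?_⟩
  · ext x
    exact congrArg Subtype.val (hp (p x))
  · ext x
    exact congrArg Subtype.val (hp ⟨g x, x, rfl⟩)
  · ext x
    change ((re.symm (p (g x)) : R) : Y) = (p x : Y)
    congr 1
    rw [LinearEquiv.symm_apply_eq]
    refine Subtype.ext ?_
    change ((p (g x) : R) : Y) = g (p x)
    rw [hgp]
    exact congrArg Subtype.val (hp ⟨g x, x, rfl⟩)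
  · ext x
    change g (re.symm (p x) : R) = (p x : Y)
    exact congrArg Subtype.val (re.apply_symm_apply (p x))

/-- If every idempotent endomorphism becomes trivial in a quotient ring of the endomorphism
ring, then every element of this quotient is nilpotent or invertible. -/
lemma isNilpotent_or_isUnit [IsNoetherian B Y] [IsArtinian B Y] {S : Type*} [Ring S]
    (q : Module.End B Y →+* S) (hq : ∀ e : Module.End B Y, e * e = e → q e = 0 ∨ q e = 1)
    (f : Module.End B Y) : IsNilpotent (q f) ∨ IsUnit (q f) := by
  obtain ⟨n, e, v, hn, hee, hef, hvf, hfv⟩ := exists_fitting f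
  rcases hq e hee with h | h
  · left
    refine ⟨n, ?_⟩
    rw [← map_pow, ← hef, map_mul, h, zero_mul]
  · right
    rw [← isUnit_pow_iff hn, ← map_pow]
    refine ⟨⟨q (f ^ n), q v, ?_, ?_⟩, rfl⟩
    · rw [← map_mul, hfv, h]
    · rw [← map_mul, hvf, h]

lemma isLocalRing_of_isNilpotent_or_isUnit {S : Type*} [Ring S] [Nontrivial S]
    (h : ∀ x : S, IsNilpotent x ∨ IsUnit x) : IsLocalRing S where
  isUnit_or_isUnit_of_add_one {a b} hab := by
    rcases h a with ha | ha
    · right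
      rw [← add_sub_cancel_left a b, hab]
      exact ha.isUnit_one_sub
    · exact Or.inl ha

lemma isUnit_of_isUnit_mul {S : Type*} [Ring S] [Nontrivial S]
    (h : ∀ x : S, IsNilpotent x ∨ IsUnit x) {a b : S} (hab : IsUnit (a * b)) :
    IsUnit b := by
  refine (h b).resolve_left fun hb => ?_
  obtain ⟨c, hc⟩ := hab
  obtain ⟨n, hn⟩ := hb
  have h1 : (↑c⁻¹ * a) * b = 1 := by rw [mul_assoc, ← hc, Units.inv_mul]
  have h2 : ∀ m, (↑c⁻¹ * a) ^ m * b ^ m = 1 := by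
    intro m
    induction m with
    | zero => simp
    | succ m ih =>
      rw [pow_succ, pow_succ', mul_assoc, ← mul_assoc _ b, h1, one_mul, ih]
  have := h2 n
  rw [hn, mul_zero] at this
  exact zero_ne_one this

variable (M : Type u) [AddCommGroup M] [Module B M]

variable (B Y) in
/-- The two-sided ideal of endomorphisms of `Y` factoring through sums of copies of `M`. -/
def facIdeal : TwoSidedIdeal (Module.End B Y) :=
  TwoSidedIdeal.mk' {f | Fac M f} Fac.zero (fun h h' => Fac.add h h') (fun h => Fac.neg h)
    (fun {x _} h => Fac.comp_left h x) (fun {_ y} h => Fac.comp_right h y)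

variable (B Y) in
/-- The endomorphism ring of `Y` modulo maps factoring through sums of copies of `M`. -/
abbrev StableEnd : Type u := (facIdeal B Y M).ringCon.Quotient

variable (B Y) in
/-- The canonical map to the stable endomorphism ring. -/
def stableMk : Module.End B Y →+* StableEnd B Y M := (facIdeal B Y M).ringCon.mk'

lemma stableMk_surjective : Function.Surjective (stableMk B Y M) :=
  (facIdeal B Y M).ringCon.mk'_surjective

lemma stableMk_eq_iff (f g : Module.End B Y) :
    stableMk B Y M f = stableMk B Y M g ↔ Fac M (f - g) := by
  refine (RingCon.eq _).trans ?_
  exact Iff.rfl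

lemma stableMk_eq_zero_iff (f : Module.End B Y) : stableMk B Y M f = 0 ↔ Fac M f := by
  rw [← map_zero (stableMk B Y M), stableMk_eq_iff, sub_zero]

lemma stableMk_eq_one_iff (f : Module.End B Y) : stableMk B Y M f = 1 ↔ Fac M (1 - f) := by
  rw [eq_comm, ← map_one (stableMk B Y M), stableMk_eq_iff]

lemma idempotent_of_isIndec {Y : ModuleCat.{u} B} (hY : IsIndec Y) (e : Module.End B Y)
    (he : e * e = e) : e = 0 ∨ e = 1 := by
  have hid : IsIdempotentElem e := he
  have hc := LinearMap.IsIdempotentElem.isCompl hid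
  rcases hY.2 (ModuleCat.of B (LinearMap.range e)) (ModuleCat.of B (LinearMap.ker e))
    ⟨(Submodule.prodEquivOfIsCompl _ _ hc).symm⟩ with h | h
  · left
    ext x
    have h' : Subsingleton (LinearMap.range e) := h
    exact congrArg Subtype.val (Subsingleton.elim (⟨e x, x, rfl⟩ : LinearMap.range e) 0)
  · right
    ext x
    have h' : Subsingleton (LinearMap.ker e) := h
    have hx : x - e x ∈ LinearMap.ker e := by
      rw [LinearMap.mem_ker, map_sub, sub_eq_zero]
      exact (LinearMap.congr_fun he x).symm
    have := congrArg Subtype.val (Subsingleton.elim (⟨_, hx⟩ : LinearMap.ker e) 0)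
    exact (sub_eq_zero.1 this).symm

end Fitting

end TiltingComplements

namespace TiltingComplements

open Abelian

section KDual

variable (k : Type u) [Field k] (B : Type u) [Ring B] [Algebra k B]

/-- The `k`-dual of the regular module, with its left module structure
`(b • φ) x = φ (x * b)`. -/
def KDual : Type u := B →ₗ[k] k

instance : AddCommGroup (KDual k B) := inferInstanceAs (AddCommGroup (B →ₗ[k] k))

instance : FunLike (KDual k B) B k := inferInstanceAs (FunLike (B →ₗ[k] k) B k)

instance : LinearMapClass (KDual k B) k B k :=
  inferInstanceAs (LinearMapClass (B →ₗ[k] k) k B k)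

instance : Module B (KDual k B) where
  smul b φ := LinearMap.comp (φ : B →ₗ[k] k) (LinearMap.mulRight k b)
  one_smul φ := LinearMap.ext fun x => congrArg (φ : B →ₗ[k] k) (mul_one x)
  mul_smul b c φ := LinearMap.ext fun x => congrArg (φ : B →ₗ[k] k) (mul_assoc x b c).symm
  smul_zero _ := LinearMap.ext fun _ => rfl
  zero_smul φ := LinearMap.ext fun x =>
    (congrArg (φ : B →ₗ[k] k) (mul_zero x)).trans (map_zero (φ : B →ₗ[k] k))
  smul_add _ _ _ := LinearMap.ext fun _ => rfl
  add_smul b c φ := LinearMap.ext fun x =>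
    (congrArg (φ : B →ₗ[k] k) (mul_add x b c)).trans (map_add (φ : B →ₗ[k] k) _ _)

variable {k B}

lemma KDual.smul_apply (b : B) (φ : KDual k B) (x : B) : (b • φ) x = φ (x * b) := rfl

@[ext]
lemma KDual.ext {φ ψ : KDual k B} (h : ∀ x, φ x = ψ x) : φ = ψ := LinearMap.ext h

/-- Regard a linear functional as an element of the dual module. -/
def KDual.mk (φ : B →ₗ[k] k) : KDual k B := φ

/-- The linear functional underlying an element of the dual module. -/
def KDual.toLin (φ : KDual k B) : B →ₗ[k] k := φ

lemma KDual.mk_apply (φ : B →ₗ[k] k) (x : B) : KDual.mk φ x = φ x := rfl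

lemma KDual.toLin_apply (φ : KDual k B) (x : B) : φ.toLin x = φ x := rfl

instance [Module.Finite k B] : Module.Finite B (KDual k B) := by
  classical
  obtain ⟨s, f, hf⟩ := Module.Finite.exists_fin (R := k) (M := B →ₗ[k] k)
  refine ⟨⟨Finset.univ.image (fun i => KDual.mk (f i)), eq_top_iff.2 fun φ _ => ?_⟩⟩
  have hg : φ.toLin ∈ Submodule.span k (Set.range f) := hf ▸ Submodule.mem_top
  obtain ⟨c, hc⟩ := (Submodule.mem_span_range_iff_exists_fun k).1 hg
  have : φ = ∑ i, algebraMap k B (c i) • KDual.mk (f i) := by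
    rw [show φ = KDual.mk φ.toLin from rfl, ← hc]
    refine LinearMap.ext fun x => ?_
    have h1 : KDual.mk (∑ i, c i • f i) = ∑ i, KDual.mk (c i • f i) := rfl
    have h2 : ∀ i, KDual.mk (c i • f i) = algebraMap k B (c i) • KDual.mk (f i) := by
      intro i
      ext x
      rw [KDual.smul_apply, KDual.mk_apply, KDual.mk_apply, ← Algebra.commutes,
        ← Algebra.smul_def, map_smul, LinearMap.smul_apply]
    rw [h1, Finset.sum_congr rfl fun i _ => h2 i]
  rw [this]
  exact Submodule.sum_mem _ fun i _ => Submodule.smul_mem _ _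
    (Submodule.subset_span (by simp))

/-- The `B`-linear map to the dual module induced by a linear functional. -/
def KDual.lift {X : Type u} [AddCommGroup X] [Module B X] [Module k X] [IsScalarTower k B X]
    (l : X →ₗ[k] k) : X →ₗ[B] KDual k B where
  toFun x := KDual.mk (l.comp ((LinearMap.toSpanSingleton B X x).restrictScalars k))
  map_add' x y := LinearMap.ext fun b => by
    change l (b • (x + y)) = l (b • x) + l (b • y)
    rw [smul_add, map_add]
  map_smul' c x := LinearMap.ext fun b => by
    change l (b • c • x) = l ((b * c) • x)
    rw [mul_smul]

lemma KDual.lift_apply {X : Type u} [AddCommGroup X] [Module B X] [Module k X]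
    [IsScalarTower k B X] (l : X →ₗ[k] k) (x : X) (b : B) : KDual.lift l x b = l (b • x) := rfl

variable (k B) in
instance KDual.injective : Module.Injective B (KDual k B) where
  out X Y _ _ _ _ f hf g := by
    let _ : Module k X := Module.compHom X (algebraMap k B)
    let _ : Module k Y := Module.compHom Y (algebraMap k B)
    have hX : IsScalarTower k B X := ⟨fun c b x => by
      rw [Algebra.smul_def, mul_smul]; rfl⟩
    have hY : IsScalarTower k B Y := ⟨fun c b x => by
      rw [Algebra.smul_def, mul_smul]; rfl⟩
    let l : X →ₗ[k] k :=
      { toFun := fun x => g x 1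
        map_add' := fun x y => by rw [map_add]; rfl
        map_smul' := fun c x => by
          change g (algebraMap k B c • x) 1 = c • g x 1
          rw [map_smul, KDual.smul_apply, one_mul, ← KDual.toLin_apply, ← KDual.toLin_apply,
            ← map_smul, Algebra.smul_def, mul_one] }
    obtain ⟨r, hr⟩ := (f.restrictScalars k).exists_leftInverse_of_injective
      (LinearMap.ker_eq_bot.2 hf)
    refine ⟨KDual.lift (l.comp r), fun x => ?_⟩
    ext b
    have h1 : r (b • f x) = b • x := by
      rw [← map_smul]
      exact LinearMap.congr_fun hr (b • x)
    rw [KDual.lift_apply, LinearMap.comp_apply, h1]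
    change g (b • x) 1 = g x b
    rw [map_smul, KDual.smul_apply, one_mul]

/-- Finitely generated modules embed in finitely generated Ext-injective modules. -/
lemma exists_injective_embedding (k : Type u) [Field k] {B : Type u} [Ring B] [Algebra k B]
    [Module.Finite k B] (Z : Type u) [AddCommGroup Z] [Module B Z] [Module.Finite B Z] :
    ∃ (n : ℕ) (f : Z →ₗ[B] (Fin n → KDual k B)), Function.Injective f := by
  let _ : Module k Z := Module.compHom Z (algebraMap k B)
  have hZ : IsScalarTower k B Z := ⟨fun c b x => by
    rw [Algebra.smul_def, mul_smul]; rfl⟩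
  have : Module.Finite k Z := Module.Finite.trans B Z
  let b := Module.finBasis k Z
  refine ⟨Module.finrank k Z, LinearMap.pi fun i => KDual.lift (b.coord i), ?_⟩
  rw [← LinearMap.ker_eq_bot, LinearMap.ker_eq_bot']
  intro z hz
  refine b.ext_elem fun i => ?_
  have := DFunLike.congr_fun (congrFun hz i) (1 : B)
  rw [LinearMap.pi_apply, KDual.lift_apply, one_smul] at this
  rw [map_zero]
  exact this

end KDual

end TiltingComplements

namespace TiltingComplements

open Abelian

section Tilting

variable {B : Type u} [Ring B]

variable (B) in
/-- Vanishing of all higher Ext groups from `X` to `Y`. -/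
def Orth (X Y : Type u) [AddCommGroup X] [Module B X] [AddCommGroup Y] [Module B Y] : Prop :=
  ∀ i : ℕ, ExtVanish B X Y (i + 1)

variable {X Y Z T S W M K E : Type u} [AddCommGroup X] [Module B X] [AddCommGroup Y] [Module B Y]
  [AddCommGroup Z] [Module B Z] [AddCommGroup T] [Module B T] [AddCommGroup S] [Module B S]
  [AddCommGroup W] [Module B W] [AddCommGroup M] [Module B M] [AddCommGroup K] [Module B K]
  [AddCommGroup E] [Module B E]

lemma Orth.pi_left (h : Orth B X Y) (n : ℕ) : Orth B (Fin n → X) Y := fun i =>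
  extVanish_pi_left fun _ => h i

lemma Orth.pi_right (h : Orth B X Y) (n : ℕ) : Orth B X (Fin n → Y) := fun i =>
  extVanish_pi_right fun _ => h i

lemma IsShortExact.exists_desc {f : K →ₗ[B] E} {g : E →ₗ[B] Y} (h : IsShortExact f g)
    (p : E →ₗ[B] W) (hp : p.comp f = 0) : ∃ q : Y →ₗ[B] W, q.comp g = p := by
  have hker : LinearMap.ker g ≤ LinearMap.ker p := by
    intro x hx
    obtain ⟨y, rfl⟩ := (h.exact x).1 hx
    exact LinearMap.congr_fun hp y
  refine ⟨((LinearMap.ker g).liftQ p hker).comp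
    (g.quotKerEquivOfSurjective h.surj).symm.toLinearMap, ?_⟩
  ext x
  have : (g.quotKerEquivOfSurjective h.surj).symm (g x) = (LinearMap.ker g).mkQ x := by
    rw [LinearEquiv.symm_apply_eq]; rfl
  change (LinearMap.ker g).liftQ p hker ((g.quotKerEquivOfSurjective h.surj).symm (g x)) = p x
  rw [this]; rfl

lemma IsShortExact.exists_lift_ker {f : K →ₗ[B] E} {g : E →ₗ[B] Y} (h : IsShortExact f g)
    (p : W →ₗ[B] E) (hp : g.comp p = 0) : ∃ q : W →ₗ[B] K, f.comp q = p := by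
  have hr : ∀ x, p x ∈ LinearMap.range f := fun x => (h.exact (p x)).1 (LinearMap.congr_fun hp x)
  refine ⟨(LinearEquiv.ofInjective f h.inj).symm.toLinearMap.comp (p.codRestrict _ hr), ?_⟩
  ext x
  change f ((LinearEquiv.ofInjective f h.inj).symm ⟨p x, hr x⟩) = p x
  exact congrArg Subtype.val ((LinearEquiv.ofInjective f h.inj).apply_symm_apply ⟨p x, hr x⟩)

lemma coresolvedBy_orth {T : ModuleCat.{u} B} (hZ : Orth B T Z) (d : ℕ) :
    ∀ X : ModuleCat.{u} B, CoresolvedBy T X d →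
      Orth B X Z ∧ ∀ h : X →ₗ[B] Z, LinearMap.range h ≤ trace B T Z := by
  induction d with
  | zero =>
    intro X hX
    have hf : Fac T (LinearMap.id : X →ₗ[B] X) := (memAdd_iff_fac T X).1 hX
    exact ⟨fun i => extVanish_of_fac_left hf (hZ i), fun h => (hf.comp_left h).range_le_trace⟩
  | succ d ih =>
    rintro X ⟨T₀, hT₀, f, hf, hC⟩
    have hT : Fac T (LinearMap.id : T₀ →ₗ[B] T₀) := (memAdd_iff_fac T T₀).1 hT₀
    obtain ⟨h1, -⟩ := ih _ hC
    have hS := isShortExact_mkQ f hf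
    refine ⟨fun i => hS.extVanish_left' (extVanish_of_fac_left hT (hZ i)) (h1 (i + 1)),
      fun h => ?_⟩
    obtain ⟨q, rfl⟩ := hS.exists_extend (h1 0) h
    exact ((hT.comp_left q).comp_right f).range_le_trace

lemma trace_eq_top_of_isTilting {T : ModuleCat.{u} B} (hT : IsTilting T) (hZ : Orth B T Z) :
    trace B T Z = ⊤ := by
  obtain ⟨-, -, d, hd⟩ := hT
  refine eq_top_iff.2 fun z _ => ?_
  exact (coresolvedBy_orth hZ d _ hd).2 (LinearMap.toSpanSingleton B Z z) ⟨1, by simp⟩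

lemma trace_prod_le : trace B (M × Y) Z ≤ trace B M Z ⊔ trace B Y Z := by
  refine iSup_le fun f => ?_
  rintro _ ⟨⟨m, y⟩, rfl⟩
  have : f (m, y) = f.comp (LinearMap.inl B M Y) m + f.comp (LinearMap.inr B M Y) y := by
    simp [← map_add]
  rw [this]
  exact Submodule.add_mem_sup (range_le_trace _ ⟨_, rfl⟩) (range_le_trace _ ⟨_, rfl⟩)

lemma trace_le_trace_prod : trace B M Z ⊔ trace B Y Z ≤ trace B (M × Y) Z := by
  refine sup_le (iSup_le fun f => ?_) (iSup_le fun f => ?_)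
  · rintro _ ⟨m, rfl⟩
    exact range_le_trace (f.comp (LinearMap.fst B M Y)) ⟨(m, 0), rfl⟩
  · rintro _ ⟨m, rfl⟩
    exact range_le_trace (f.comp (LinearMap.snd B M Y)) ⟨(0, m), rfl⟩

variable (B) in
/-- `Y` behaves like an indecomposable tilting complement of `M`. -/
structure Good (M Y : Type u) [AddCommGroup M] [Module B M] [AddCommGroup Y] [Module B Y] :
    Prop where
  mm : Orth B M M
  my : Orth B M Y
  ym : Orth B Y M
  yy : Orth B Y Y
  fpd_left : FPD B M
  fpd : FPD B Y
  gen : ∀ (Z : Type u) [AddCommGroup Z] [Module B Z] [Module.Finite B Z], Orth B M Z →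
    Orth B Y Z → trace B M Z ⊔ trace B Y Z = ⊤
  not_fac : ¬ Fac M (1 : Module.End B Y)
  idem : ∀ e : Module.End B Y, e * e = e → Fac M e ∨ Fac M (1 - e)

lemma Good.of_isComplement {M Y : ModuleCat.{u} B} (h : IsComplement M Y) : Good B M Y := by
  obtain ⟨-, hind, hadd, hT⟩ := h
  have hself : Orth B (M × Y) (M × Y) := fun i => hT.2.1 (i + 1) i.succ_pos
  have hL : ∀ {Z : Type u} [AddCommGroup Z] [Module B Z] {i}, ExtVanish B (M × Y) Z i →
      ExtVanish B M Z i := fun h =>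
    extVanish_retract_left (LinearMap.inl B M Y) (LinearMap.fst B M Y) (by ext; rfl) h
  have hR : ∀ {Z : Type u} [AddCommGroup Z] [Module B Z] {i}, ExtVanish B (M × Y) Z i →
      ExtVanish B Y Z i := fun h =>
    extVanish_retract_left (LinearMap.inr B M Y) (LinearMap.snd B M Y) (by ext; rfl) h
  have hL' : ∀ {Z : Type u} [AddCommGroup Z] [Module B Z] {i}, ExtVanish B Z (M × Y) i →
      ExtVanish B Z M i := fun h =>
    extVanish_retract_right (LinearMap.inl B M Y) (LinearMap.fst B M Y) (by ext; rfl) h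
  have hR' : ∀ {Z : Type u} [AddCommGroup Z] [Module B Z] {i}, ExtVanish B Z (M × Y) i →
      ExtVanish B Z Y i := fun h =>
    extVanish_retract_right (LinearMap.inr B M Y) (LinearMap.snd B M Y) (by ext; rfl) h
  have hfpd : FPD B (M × Y) := FPD.of_hasFiniteProjDim hT.1
  exact
    { mm := fun i => hL (hL' (hself i))
      my := fun i => hL (hR' (hself i))
      ym := fun i => hR (hL' (hself i))
      yy := fun i => hR (hR' (hself i))
      fpd_left := hfpd.retract (LinearMap.inl B M Y) (LinearMap.fst B M Y) (by ext; rfl)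
      fpd := hfpd.retract (LinearMap.inr B M Y) (LinearMap.snd B M Y) (by ext; rfl)
      gen := fun Z _ _ _ hM hY => by
        refine top_le_iff.1 (le_trans ?_ trace_prod_le)
        exact (trace_eq_top_of_isTilting hT (Z := Z) fun i => extVanish_prod_left (hM i) (hY i)).ge
      not_fac := fun h => hadd ((memAdd_iff_fac M Y).2 h)
      idem := fun e he => by
        rcases idempotent_of_isIndec hind e he with rfl | rfl
        · exact Or.inl Fac.zero
        · right; rw [sub_self]; exact Fac.zero }

lemma Good.nontrivial (h : Good B M Y) : Nontrivial (StableEnd B Y M) := by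
  refine ⟨⟨0, 1, fun h01 => h.not_fac ?_⟩⟩
  rw [← stableMk_eq_zero_iff, map_one, h01]

lemma Good.isNilpotent_or_isUnit [IsNoetherian B Y] [IsArtinian B Y] (h : Good B M Y)
    (x : StableEnd B Y M) : IsNilpotent x ∨ IsUnit x := by
  obtain ⟨f, rfl⟩ := stableMk_surjective M x
  refine TiltingComplements.isNilpotent_or_isUnit _ (fun e he => ?_) f
  rw [stableMk_eq_zero_iff, stableMk_eq_one_iff]
  exact h.idem e he

lemma exists_orth_approx (k : Type u) [Field k] [Algebra k B] [Module.Finite k B]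
    [Module.Finite B T] [Module.Finite B Z] (hT : Orth B T T) (hZ : Orth B T Z)
    (htop : trace B T Z = ⊤) :
    ∃ (a : ℕ) (g : (Fin a → T) →ₗ[B] Z), Function.Surjective g ∧
      (∀ f : T →ₗ[B] Z, ∃ c : T →ₗ[B] (Fin a → T), g.comp c = f) ∧
      Orth B T (LinearMap.ker g) := by
  obtain ⟨a, g, hg, hl⟩ := exists_approx k (B := B) T Z
  have hs : Function.Surjective g := LinearMap.range_eq_top.1 (hg.trans htop)
  refine ⟨a, g, hs, hl, fun i => ?_⟩
  have hS := isShortExact_ker g hs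
  cases i with
  | zero => exact hS.extVanish_one_left (hT.pi_right a 0) hl
  | succ i => exact hS.extVanish_left (hZ i) (hT.pi_right a (i + 1))

lemma exists_decomposition (k : Type u) [Field k] [Algebra k B] [Module.Finite k B]
    [IsNoetherianRing B] [Module.Finite B M] [Module.Finite B X] [Module.Finite B Y]
    (hMM : Orth B M M) (hMX : Orth B M X) (hXM : Orth B X M) (hXX : Orth B X X)
    (hgen : ∀ (Z : Type u) [AddCommGroup Z] [Module B Z] [Module.Finite B Z], Orth B M Z →
      Orth B X Z → trace B M Z ⊔ trace B X Z = ⊤)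
    (hfpd : FPD B Y) (hMY : Orth B M Y) (hXY : Orth B X Y) (hYM : Orth B Y M)
    (hYX : Orth B Y X) :
    ∃ c d : Module.End B Y, Fac M c ∧ Fac X d ∧ c + d = 1 := by
  obtain ⟨D, hD⟩ := hfpd
  have hTT : Orth B (M × X) (M × X) := fun i => extVanish_prod_left
    (extVanish_prod_right (hMM i) (hMX i)) (extVanish_prod_right (hXM i) (hXX i))
  have hYT : Orth B Y (M × X) := fun i => extVanish_prod_right (hYM i) (hYX i)
  have happ : ∀ (Z : Type u) [AddCommGroup Z] [Module B Z] [Module.Finite B Z],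
      Orth B (M × X) Z → trace B (M × X) Z = ⊤ := by
    intro Z _ _ _ hZ
    refine top_le_iff.1 (le_trans (hgen Z (fun i => ?_) (fun i => ?_)).ge trace_le_trace_prod)
    · exact extVanish_retract_left (LinearMap.inl B M X) (LinearMap.fst B M X) (by ext; rfl) (hZ i)
    · exact extVanish_retract_left (LinearMap.inr B M X) (LinearMap.snd B M X) (by ext; rfl) (hZ i)
  have key : ∀ m : ℕ, ∀ (K : Type u) [AddCommGroup K] [Module B K] [Module.Finite B K],
      Orth B (M × X) K → ∀ j, D ≤ j + m → ExtVanish B Y K (j + 1) := by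
    intro m
    induction m with
    | zero => intro K _ _ _ _ j hj; exact hD (j + 1) (by omega) K
    | succ m ih =>
      intro K _ _ _ hK j hj
      obtain ⟨a, g, hs, -, hK'⟩ := exists_orth_approx k hTT hK (happ K hK)
      exact (isShortExact_ker g hs).extVanish_right (hYT.pi_right a j)
        (ih (LinearMap.ker g) hK' (j + 1) (by omega))
  have hTY : Orth B (M × X) Y := fun i => extVanish_prod_left (hMY i) (hXY i)
  obtain ⟨a, g, hs, -, hK'⟩ := exists_orth_approx k hTT hTY (happ Y hTY)
  obtain ⟨s, hsec⟩ := (isShortExact_ker g hs).exists_lift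
    (key D (LinearMap.ker g) hK' 0 (by omega)) (LinearMap.id : Y →ₗ[B] Y)
  obtain ⟨n, p, q, hpq⟩ := (fac_comp_pi (T := M × X) g s).exists_sum
  refine ⟨∑ i, ((q i).comp (LinearMap.inl B M X)).comp ((LinearMap.fst B M X).comp (p i)),
    ∑ i, ((q i).comp (LinearMap.inr B M X)).comp ((LinearMap.snd B M X).comp (p i)),
    Fac.sum _ fun i _ => fac_comp _ _, Fac.sum _ fun i _ => fac_comp _ _, ?_⟩
  rw [← Finset.sum_add_distrib]
  refine Eq.trans (Finset.sum_congr rfl fun i _ => ?_) (hpq.trans hsec)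
  ext y
  simp [← map_add]

end Tilting

end TiltingComplements

namespace TiltingComplements

open Abelian

section Source

variable {B : Type u} [Ring B]
variable {Y Z M : Type u} [AddCommGroup Y] [Module B Y]
  [AddCommGroup Z] [Module B Z] [AddCommGroup M] [Module B M]

lemma finite_end (k : Type u) [Field k] [Algebra k B] [Module.Finite k B] (Y : Type u)
    [AddCommGroup Y] [Module B Y] [Module.Finite B Y] : Module.Finite (Module.End B Y) Y := by
  classical
  let _ : Module k Y := Module.compHom Y (algebraMap k B)
  have hY : IsScalarTower k B Y := ⟨fun c b x => by
    rw [Algebra.smul_def, mul_smul]; rfl⟩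
  have : Module.Finite k Y := Module.Finite.trans B Y
  obtain ⟨s, f, hf⟩ := Module.Finite.exists_fin (R := k) (M := Y)
  refine ⟨⟨Finset.univ.image f, eq_top_iff.2 fun y _ => ?_⟩⟩
  have hy : y ∈ Submodule.span k (Set.range f) := hf ▸ Submodule.mem_top
  obtain ⟨c, rfl⟩ := (Submodule.mem_span_range_iff_exists_fun k).1 hy
  exact Submodule.sum_mem _ fun i _ =>
    Submodule.smul_mem _ (scalarEnd k B Y (c i) : Module.End B Y)
      (Submodule.subset_span (by simp))

/-- If `M` does not generate `Y` then the images of all radical endomorphisms of `Y` lie in a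
proper subset closed under addition and containing the trace of `M`. -/
lemma Good.exists_coatom (k : Type u) [Field k] [Algebra k B] [Module.Finite k B]
    [IsNoetherianRing B] [IsArtinianRing B] [Module.Finite B Y] (h : Good B M Y)
    (htr : trace B M Y ≠ ⊤) :
    ∃ N : AddSubgroup Y, N ≠ ⊤ ∧ (trace B M Y).toAddSubgroup ≤ N ∧
      ∀ f : Module.End B Y, ¬ IsUnit (stableMk B Y M f) → ∀ y, f y ∈ N := by
  have := h.nontrivial
  have := finite_end k (B := B) Y
  let T : Submodule (Module.End B Y) Y :=
    { (trace B M Y).toAddSubgroup with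
      smul_mem' := fun g y hy => map_trace_le g ⟨y, hy, rfl⟩ }
  have hT : T ≠ ⊤ := fun hT => htr (eq_top_iff.2 fun y _ =>
    (hT ▸ Submodule.mem_top : y ∈ T))
  obtain ⟨N, hN, hTN⟩ := (eq_top_or_exists_le_coatom T).resolve_left hT
  refine ⟨N.toAddSubgroup, fun hN' => hN.1 (eq_top_iff.2 fun y _ => ?_), fun y hy => hTN hy,
    fun f hf y => ?_⟩
  · have : y ∈ N.toAddSubgroup := hN' ▸ AddSubgroup.mem_top y
    exact this
  · change f y ∈ N
    by_contra hy
    have hlt : N < N ⊔ Submodule.span (Module.End B Y) {f y} :=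
      lt_of_le_of_ne le_sup_left fun he =>
        hy (he ▸ (le_sup_right : _ ≤ N ⊔ _) (Submodule.mem_span_singleton_self _))
    have hy' : y ∈ N ⊔ Submodule.span (Module.End B Y) {f y} :=
      hN.2 _ hlt ▸ Submodule.mem_top
    obtain ⟨w, hw, z, hz, hwz⟩ := Submodule.mem_sup.1 hy'
    obtain ⟨g, rfl⟩ := Submodule.mem_span_singleton.1 hz
    have hgf : ¬ IsUnit (stableMk B Y M (g * f)) := fun hu =>
      hf (isUnit_of_isUnit_mul h.isNilpotent_or_isUnit (map_mul (stableMk B Y M) g f ▸ hu))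
    obtain ⟨n, hn⟩ := (h.isNilpotent_or_isUnit _).resolve_right hgf
    rw [← map_pow, stableMk_eq_zero_iff] at hn
    have h1 : (1 - g * f) • y ∈ N := by
      have : (1 - g * f) • y = w := by
        rw [sub_smul, one_smul, mul_smul, sub_eq_iff_eq_add]
        exact hwz.symm
      rwa [this]
    have h2 : (1 - (g * f) ^ n) • y ∈ N := by
      rw [← geom_sum_mul_neg, mul_smul]
      exact N.smul_mem _ h1
    have h3 : ((g * f) ^ n) • y ∈ N := hTN (hn.range_le_trace ⟨y, rfl⟩)
    have h4 : y ∈ N := by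
      have := N.add_mem h2 h3
      rwa [← add_smul, sub_add_cancel, one_smul] at this
    exact hy (N.smul_mem f h4)

lemma mk₀_comp_eq_zero_of_fac {X : Type u} [AddCommGroup X] [Module B X] {f : X →ₗ[B] Y}
    (hf : Fac M f) (hM : ExtVanish B M Z 1)
    (ξ : Ext.{u + 1} (ModuleCat.of B Y) (ModuleCat.of B Z) 1) :
    (Ext.mk₀ (ModuleCat.ofHom f)).comp ξ (zero_add 1) = 0 := by
  obtain ⟨n, a, b, rfl⟩ := hf.exists_sum
  have : ModuleCat.ofHom (∑ i, (b i).comp (a i)) =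
      ∑ i, ModuleCat.ofHom (a i) ≫ ModuleCat.ofHom (b i) := by
    apply ModuleCat.hom_ext
    rw [ModuleCat.hom_sum]; rfl
  rw [this, mk₀_finsetSum, finsetSum_comp]
  refine Finset.sum_eq_zero fun i _ => ?_
  rw [← Ext.mk₀_comp_mk₀_assoc, hM.elim ((Ext.mk₀ (ModuleCat.ofHom (b i))).comp ξ _) 0,
    Ext.comp_zero]

lemma Good.extVanish_one (k : Type u) [Field k] [Algebra k B] [Module.Finite k B]
    [IsNoetherianRing B] [IsArtinianRing B] [Module.Finite B Y] (h : Good B M Y)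
    (htr : trace B M Y ≠ ⊤) [Module.Finite B Z] (hMZ : Orth B M Z)
    (hYZ : ∀ j, ExtVanish B Y Z (j + 2)) : ExtVanish B Y Z 1 := by
  classical
  let P : ℕ → Prop := fun s =>
    ∃ ξ : Fin s → Ext.{u + 1} (ModuleCat.of B Y) (ModuleCat.of B Z) 1,
      ∀ η : Ext.{u + 1} (ModuleCat.of B Y) (ModuleCat.of B Z) 1, ∃ f : Fin s → (Y →ₗ[B] Y),
        η = ∑ i, (Ext.mk₀ (ModuleCat.ofHom (f i))).comp (ξ i) (zero_add 1)
  have hP : ∃ s, P s := exists_ext_generators k Y Z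
  obtain ⟨s, ⟨ξ, hξ⟩, hmin⟩ : ∃ s, P s ∧ ∀ t, t < s → ¬ P t :=
    ⟨Nat.find hP, Nat.find_spec hP, fun t ht => Nat.find_min hP ht⟩
  cases s with
  | zero =>
    refine subsingleton_of_forall_eq 0 fun η => ?_
    obtain ⟨f, rfl⟩ := hξ η
    rfl
  | succ s =>
    exfalso
    obtain ⟨F, _, _, _, i, p, hS, hrel, hvan⟩ := exists_universal_extension (s + 1) ξ
    have hMF : Orth B M F := fun j => hS.extVanish_middle (hMZ j) (h.my.pi_right _ j)
    have hYF : Orth B Y F := by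
      intro j
      cases j with
      | zero => exact hvan hξ (h.yy 0)
      | succ j => exact hS.extVanish_middle (hYZ j) (h.yy.pi_right _ (j + 1))
    have htop := h.gen F hMF hYF
    obtain ⟨N, hN, htN, hrad⟩ := h.exists_coatom k htr
    let π : F →ₗ[B] Y := (LinearMap.proj 0).comp p
    have hnu : ∀ y : Y →ₗ[B] F, ¬ IsUnit (stableMk B Y M (π.comp y)) := by
      intro y hu
      obtain ⟨v, hv⟩ := hu.exists_right_inv
      obtain ⟨g, rfl⟩ := stableMk_surjective M v
      rw [← map_mul, stableMk_eq_one_iff] at hv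
      refine hmin s s.lt_succ_self ⟨fun j => ξ j.succ, fun η => ?_⟩
      have h0 : ξ 0 = ∑ j : Fin s, (Ext.mk₀ (ModuleCat.ofHom
          (-((LinearMap.proj j.succ).comp (p.comp (y.comp g)))))).comp (ξ j.succ)
          (zero_add 1) := by
        have h1 := hrel (y.comp g)
        rw [Fin.sum_univ_succ] at h1
        have h2 := mk₀_comp_eq_zero_of_fac hv (hMZ 0) (ξ 0)
        have h3 : ModuleCat.ofHom (1 - (π.comp y) * g : Module.End B Y) =
            𝟙 (ModuleCat.of B Y) +
              -ModuleCat.ofHom ((LinearMap.proj 0).comp (p.comp (y.comp g))) := by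
          rw [← sub_eq_add_neg]; rfl
        rw [h3, Ext.mk₀_add, Ext.add_comp, Ext.mk₀_id_comp, Ext.mk₀_neg, Ext.neg_comp,
          ← sub_eq_add_neg, sub_eq_zero] at h2
        rw [← h2] at h1
        rw [eq_neg_of_add_eq_zero_left h1, ← Finset.sum_neg_distrib]
        refine Finset.sum_congr rfl fun j _ => ?_
        rw [← Ext.neg_comp, ← Ext.mk₀_neg]
        rfl
      obtain ⟨f, rfl⟩ := hξ η
      refine ⟨fun j => f j.succ + (-((LinearMap.proj j.succ).comp (p.comp (y.comp g)))).comp (f 0),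
        ?_⟩
      rw [Fin.sum_univ_succ, h0, comp_finsetSum, ← Finset.sum_add_distrib]
      refine Finset.sum_congr rfl fun j _ => ?_
      rw [Ext.mk₀_comp_mk₀_assoc, ← Ext.add_comp, ← Ext.mk₀_add, add_comm]
      rfl
    apply hN
    rw [eq_top_iff]
    intro y _
    obtain ⟨x, rfl⟩ : ∃ x, π x = y := by
      obtain ⟨x, hx⟩ := hS.surj (fun _ => y)
      exact ⟨x, congrFun hx 0⟩
    have hx : x ∈ trace B M F ⊔ trace B Y F := htop ▸ Submodule.mem_top
    obtain ⟨a, ha, b, hb, rfl⟩ := Submodule.mem_sup.1 hx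
    rw [map_add]
    refine N.add_mem (htN (map_trace_le π ⟨a, ha, rfl⟩)) ?_
    refine Submodule.iSup_induction _ (motive := fun b => π b ∈ N) hb ?_ ?_ ?_
    · rintro f _ ⟨z, rfl⟩
      exact hrad (π.comp f) (hnu f) z
    · rw [map_zero]; exact N.zero_mem
    · intro b c hb hc
      rw [map_add]; exact N.add_mem hb hc

lemma Good.orth (k : Type u) [Field k] [Algebra k B] [Module.Finite k B]
    [IsNoetherianRing B] [IsArtinianRing B] [Module.Finite B Y] (h : Good B M Y)
    (htr : trace B M Y ≠ ⊤) [Module.Finite B Z] (hMZ : Orth B M Z) : Orth B Y Z := by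
  have key : ∀ m : ℕ, ∀ (Z : Type u) [AddCommGroup Z] [Module B Z] [Module.Finite B Z],
      Orth B M Z → (∀ j, ExtVanish B Y Z (j + m + 2)) → ExtVanish B Y Z (m + 1) := by
    intro m
    induction m with
    | zero => intro Z _ _ _ hZ hj; exact h.extVanish_one k htr hZ hj
    | succ m ih =>
      intro Z _ _ _ hZ hj
      obtain ⟨n, f, hf⟩ := exists_injective_embedding k (B := B) Z
      have hS := isShortExact_mkQ f hf
      have hI : ∀ (X : Type u) [AddCommGroup X] [Module B X],
          Orth B X (Fin n → KDual k B) := fun X _ _ i =>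
        extVanish_pi_right fun _ => extVanish_of_injective i
      exact hS.extVanish_left (ih _ (fun i => hS.extVanish_right (hI M i) (hZ (i + 1)))
        fun j => hS.extVanish_right (hI Y (j + m + 1)) (hj j)) (hI Y (m + 1))
  obtain ⟨D, hD⟩ := h.fpd
  have key2 : ∀ m j, D ≤ j + m → ExtVanish B Y Z (j + 1) := by
    intro m
    induction m with
    | zero => intro j hj; exact hD (j + 1) (by omega) Z
    | succ m ih =>
      intro j hj
      exact key j Z hMZ fun j' => ih (j' + j + 1) (by omega)
  exact fun j => key2 D j (by omega)

end Source

end TiltingComplements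

namespace TiltingComplements

open Abelian

section Exchange

variable {B : Type u} [Ring B]
variable {Y M K Z : Type u} [AddCommGroup Y] [Module B Y]
  [AddCommGroup M] [Module B M] [AddCommGroup K] [Module B K] [AddCommGroup Z] [Module B Z]

/-- An endomorphism of the kernel of an approximation factors through `M` as soon as an induced
endomorphism of the cokernel does. -/
lemma IsShortExact.fac_of_fac {a : ℕ} {f : K →ₗ[B] (Fin a → M)} {g : (Fin a → M) →ₗ[B] Y}
    (h : IsShortExact f g) (hl : ∀ p : M →ₗ[B] Y, ∃ c : M →ₗ[B] (Fin a → M), g.comp c = p)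
    {e : K →ₗ[B] K} {e' : (Fin a → M) →ₗ[B] (Fin a → M)} {e'' : Y →ₗ[B] Y}
    (h1 : e'.comp f = f.comp e) (h2 : e''.comp g = g.comp e') (hf : Fac M e'') : Fac M e := by
  obtain ⟨d, hd⟩ := Fac.lift_approx hl hf
  obtain ⟨q, hq⟩ := h.exists_lift_ker (e' - d.comp g) (by
    rw [LinearMap.comp_sub, ← h2, ← LinearMap.comp_assoc, hd, sub_self])
  have : e = q.comp f := by
    refine LinearMap.ext fun x => h.inj ?_
    have h3 := LinearMap.congr_fun hq (f x)
    have h4 := LinearMap.congr_fun h1 x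
    have h5 := h.exact.apply_apply_eq_zero x
    simp only [LinearMap.comp_apply, LinearMap.sub_apply, h5, map_zero, sub_zero] at h3 h4 ⊢
    rw [h3, h4]
  rw [this]
  exact fac_comp_pi q f

lemma Good.kernel_gen (k : Type u) [Field k] [Algebra k B] [Module.Finite k B]
    [IsNoetherianRing B] [Module.Finite B Y] (hG : Good B M Y) (htr : trace B M Y = ⊤)
    {a : ℕ} {f : K →ₗ[B] (Fin a → M)} {g : (Fin a → M) →ₗ[B] Y} (h : IsShortExact f g)
    (hl : ∀ p : M →ₗ[B] Y, ∃ c : M →ₗ[B] (Fin a → M), g.comp c = p)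
    [Module.Finite B Z] (hMZ : Orth B M Z) (hKZ : Orth B K Z) :
    trace B M Z ⊔ trace B K Z = ⊤ := by
  have hYZ : ∀ j, ExtVanish B Y Z (j + 2) := fun j =>
    h.extVanish_right' (hKZ j) (hMZ.pi_left a (j + 1))
  obtain ⟨s, ξ, hξ⟩ := exists_ext_generators k (B := B) Y Z
  obtain ⟨F, _, _, _, i, p, hS, -, hvan⟩ := exists_universal_extension s ξ
  have hMF : Orth B M F := fun j => hS.extVanish_middle (hMZ j) (hG.my.pi_right _ j)
  have hYF : Orth B Y F := by
    intro j
    cases j with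
    | zero => exact hvan hξ (hG.yy 0)
    | succ j => exact hS.extVanish_middle (hYZ j) (hG.yy.pi_right _ (j + 1))
  have htop : trace B M F = ⊤ := by
    rw [← hG.gen F hMF hYF, eq_comm, sup_eq_left]
    exact trace_le_trace_of_eq_top htr
  rw [eq_top_iff]
  intro z _
  obtain ⟨n, φ, m, hm⟩ := exists_mem_trace (htop ▸ Submodule.mem_top : i z ∈ trace B M F)
  have hx : ∀ j : Fin s, ∃ x : (Fin n → M) →ₗ[B] (Fin a → M),
      g.comp x = (LinearMap.proj j).comp (p.comp φ) := fun j =>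
    Fac.lift_approx hl ((fac_pi n).comp_left ((LinearMap.proj j).comp (p.comp φ)))
  choose x hx using hx
  have hL : ∀ j : Fin s, ∃ l : (Fin a → M) →ₗ[B] F,
      p.comp l = (LinearMap.single B (fun _ : Fin s => Y) j).comp g := fun j =>
    hS.exists_lift (hMZ.pi_left a 0) _
  choose l hL using hL
  have hk : ∀ j, ∃ q : K →ₗ[B] Z, i.comp q = (l j).comp f := fun j =>
    hS.exists_lift_ker _ (by
      rw [← LinearMap.comp_assoc, hL, LinearMap.comp_assoc, h.comp_eq_zero, LinearMap.comp_zero])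
  choose q hq using hk
  obtain ⟨r, hr⟩ := hS.exists_lift_ker (φ - ∑ j, (l j).comp (x j)) (by
    refine LinearMap.ext fun y => ?_
    have h1 : ∀ j, p (l j (x j y)) = Pi.single j (p (φ y) j) := by
      intro j
      have h2 := LinearMap.congr_fun (hL j) (x j y)
      have h3 := LinearMap.congr_fun (hx j) y
      simp only [LinearMap.comp_apply, LinearMap.proj_apply] at h2 h3
      rw [h2, h3]; rfl
    simp only [LinearMap.comp_apply, LinearMap.sub_apply, LinearMap.sum_apply, map_sub, map_sum,
      h1, LinearMap.zero_apply]
    rw [Finset.univ_sum_single, sub_self])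
  have hκ : ∀ j, ∃ κ : K, f κ = x j m := by
    intro j
    refine (h.exact _).1 ?_
    have h3 := LinearMap.congr_fun (hx j) m
    simp only [LinearMap.comp_apply, LinearMap.proj_apply] at h3
    rw [h3, hm, hS.exact.apply_apply_eq_zero]; rfl
  choose κ hκ using hκ
  have hz : z = r m + ∑ j, q j (κ j) := by
    apply hS.inj
    have h1 := LinearMap.congr_fun hr m
    have h2 : ∀ j, i (q j (κ j)) = l j (x j m) := fun j => by
      rw [← hκ]; exact LinearMap.congr_fun (hq j) (κ j)
    simp only [LinearMap.comp_apply, LinearMap.sub_apply, LinearMap.sum_apply] at h1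
    rw [map_add, map_sum, h1, hm]
    simp only [h2, sub_add_cancel]
  rw [hz]
  refine Submodule.add_mem_sup (((fac_pi n).comp_left r).range_le_trace ⟨m, rfl⟩) ?_
  exact Submodule.sum_mem _ fun j _ => TiltingComplements.range_le_trace (q j) ⟨κ j, rfl⟩

lemma Good.kernel (k : Type u) [Field k] [Algebra k B] [Module.Finite k B]
    [IsNoetherianRing B] [IsArtinianRing B] [Module.Finite B Y] (hG : Good B M Y)
    (htr : trace B M Y = ⊤)
    {a : ℕ} {f : K →ₗ[B] (Fin a → M)} {g : (Fin a → M) →ₗ[B] Y} (h : IsShortExact f g)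
    (hl : ∀ p : M →ₗ[B] Y, ∃ c : M →ₗ[B] (Fin a → M), g.comp c = p)
    (hMK : Orth B M K) : Good B M K := by
  have hKM : Orth B K M := fun i => h.extVanish_left' (hG.mm.pi_left a i) (hG.ym (i + 1))
  have hKY : Orth B K Y := fun i => h.extVanish_left' (hG.my.pi_left a i) (hG.yy (i + 1))
  refine
    { mm := hG.mm
      my := hMK
      ym := hKM
      yy := ?_
      fpd_left := hG.fpd_left
      fpd := ?_
      gen := fun Z _ _ _ hM hK => hG.kernel_gen k htr h hl hM hK
      not_fac := ?_
      idem := ?_ }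
  · intro i
    cases i with
    | zero =>
      refine h.extVanish_one_left (hKM.pi_right a 0) fun p => ?_
      obtain ⟨p', rfl⟩ := h.exists_extend (hG.yy 0) p
      obtain ⟨c, hc⟩ := Fac.lift_approx hl ((fac_pi a).comp_left p')
      exact ⟨c.comp f, by rw [← LinearMap.comp_assoc, hc]; rfl⟩
    | succ i => exact h.extVanish_left (hKY i) (hKM.pi_right a (i + 1))
  · obtain ⟨d, hd⟩ := hG.fpd_left
    obtain ⟨d', hd'⟩ := hG.fpd
    refine ⟨d + d', fun i hi W _ _ => ?_⟩
    exact h.extVanish_left' (extVanish_pi_left fun _ => hd i (by omega) W)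
      (hd' (i + 1) (by omega) W)
  · intro hf
    obtain ⟨c, hc⟩ := h.exists_lift (extVanish_of_fac_right hf (hG.ym 0)) LinearMap.id
    have h1 : (1 : Module.End B Y) = g.comp c := hc.symm
    exact hG.not_fac (h1 ▸ fac_comp_pi g c)
  · intro e he
    obtain ⟨e', he'⟩ := h.exists_extend (hG.ym.pi_right a 0) (f.comp e)
    obtain ⟨e'', he''⟩ := h.exists_desc (g.comp e') (by
      rw [LinearMap.comp_assoc, he', ← LinearMap.comp_assoc, h.comp_eq_zero, LinearMap.zero_comp])
    have hid : Fac M (e''.comp e'' - e'') := by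
      obtain ⟨d, hd⟩ := h.exists_desc (e'.comp e' - e') (by
        have he2 : e.comp e = e := he
        rw [LinearMap.sub_comp, LinearMap.comp_assoc, he', ← LinearMap.comp_assoc, he',
          LinearMap.comp_assoc, he2, sub_self])
      have : e''.comp e'' - e'' = g.comp d := by
        rw [← LinearMap.cancel_right h.surj, LinearMap.sub_comp, LinearMap.comp_assoc, he'',
          ← LinearMap.comp_assoc, he'', LinearMap.comp_assoc, LinearMap.comp_assoc, hd,
          LinearMap.comp_sub]
      rw [this]
      exact fac_comp_pi g d
    have hidem : stableMk B Y M e'' * stableMk B Y M e'' = stableMk B Y M e'' := by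
      rw [← map_mul, stableMk_eq_iff]
      exact hid
    rcases hG.isNilpotent_or_isUnit (stableMk B Y M e'') with hn | hu
    · left
      have h0 : stableMk B Y M e'' = 0 := by
        obtain ⟨n, hn⟩ := hn
        cases n with
        | zero => rw [← mul_one (stableMk B Y M e''), ← pow_zero (stableMk B Y M e''), hn, mul_zero]
        | succ n => rwa [IsIdempotentElem.pow_succ_eq n hidem] at hn
      exact h.fac_of_fac hl he' he'' ((stableMk_eq_zero_iff _ _).1 h0)
    · right
      have h1 : stableMk B Y M e'' = 1 := hu.mul_left_cancel (by rw [hidem, mul_one])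
      refine h.fac_of_fac hl (e' := 1 - e') (e'' := 1 - e'') ?_ ?_
        ((stableMk_eq_one_iff _ _).1 h1)
      · refine LinearMap.ext fun x => ?_
        have := LinearMap.congr_fun he' x
        simp only [LinearMap.comp_apply] at this
        simp [this]
      · refine LinearMap.ext fun x => ?_
        have := LinearMap.congr_fun he'' x
        simp only [LinearMap.comp_apply] at this
        simp [this]

end Exchange

end TiltingComplements

namespace TiltingComplements

open Abelian

section Levels

variable {B : Type u} [Ring B]

variable (B) in
/-- There is a short exact sequence `0 → K → M ^ a → Y → 0`. -/
def Step (M Y K : Type u) [AddCommGroup M] [Module B M] [AddCommGroup Y] [Module B Y]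
    [AddCommGroup K] [Module B K] : Prop :=
  ∃ (a : ℕ) (f : K →ₗ[B] (Fin a → M)) (g : (Fin a → M) →ₗ[B] Y), IsShortExact f g

variable (B) in
/-- The complement `Y` of `M` becomes a source after `r` exchanges. -/
def Level (M : Type u) [AddCommGroup M] [Module B M] : ℕ → ModuleCat.{u} B → Prop
  | 0, Y => Module.Finite B Y ∧ Good B M Y ∧ trace B M Y ≠ ⊤
  | r + 1, Y => Module.Finite B Y ∧ Good B M Y ∧ ∃ K : ModuleCat.{u} B, Step B M Y K ∧ Level M r K

variable {M : Type u} [AddCommGroup M] [Module B M]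

lemma Good.exists_level (k : Type u) [Field k] [Algebra k B] [Module.Finite k B]
    [IsNoetherianRing B] [IsArtinianRing B] [Module.Finite B M] (d : ℕ) :
    ∀ Y : ModuleCat.{u} B, Module.Finite B Y → Good B M Y →
      (∀ (W : Type u) [AddCommGroup W] [Module B W] [Module.Finite B W],
        Orth B M W → ExtVanish B Y W (d + 1)) →
      ∃ r ≤ d, Level B M r Y := by
  induction d with
  | zero =>
    intro Y hY hG hV
    by_cases htr : trace B M Y = ⊤
    · exfalso
      obtain ⟨a, g, hs, hl, hK⟩ := exists_orth_approx k hG.mm hG.my htr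
      have hS := isShortExact_ker g hs
      obtain ⟨c, hc⟩ := hS.exists_lift (hV (LinearMap.ker g) hK) LinearMap.id
      have h1 : (1 : Module.End B Y) = g.comp c := hc.symm
      exact hG.not_fac (h1 ▸ fac_comp_pi g c)
    · exact ⟨0, le_rfl, hY, hG, htr⟩
  | succ d ih =>
    intro Y hY hG hV
    by_cases htr : trace B M Y = ⊤
    · obtain ⟨a, g, hs, hl, hK⟩ := exists_orth_approx k hG.mm hG.my htr
      have hS := isShortExact_ker g hs
      have hGK : Good B M (LinearMap.ker g) := hG.kernel k htr hS hl hK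
      obtain ⟨r, hr, hL⟩ : ∃ r ≤ d, Level B M r (ModuleCat.of B (LinearMap.ker g)) := by
        refine ih _ (inferInstanceAs (Module.Finite B (LinearMap.ker g))) hGK fun W _ _ _ hW => ?_
        exact hS.extVanish_left' (hW.pi_left a d) (hV W hW)
      exact ⟨r + 1, by omega, hY, hG, _, ⟨a, _, g, hS⟩, hL⟩
    · exact ⟨0, by omega, hY, hG, htr⟩

lemma IsShortExact.decomposition_up {Y Y' K K' : Type u} [AddCommGroup Y] [Module B Y]
    [AddCommGroup Y'] [Module B Y'] [AddCommGroup K] [Module B K] [AddCommGroup K'] [Module B K']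
    {a a' : ℕ} {f : K →ₗ[B] (Fin a → M)} {g : (Fin a → M) →ₗ[B] Y} (h : IsShortExact f g)
    {f' : K' →ₗ[B] (Fin a' → M)} {g' : (Fin a' → M) →ₗ[B] Y'} (h' : IsShortExact f' g')
    (hY : Orth B Y M) (hY' : Orth B Y' M) {c d : Module.End B K} (hc : Fac M c) (hd : Fac K' d)
    (hcd : c + d = 1) : ∃ c d : Module.End B Y, Fac M c ∧ Fac Y' d ∧ c + d = 1 := by
  obtain ⟨n, α, β, rfl⟩ := hc.exists_pi
  obtain ⟨s, p, q, rfl⟩ := hd.exists_sum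
  obtain ⟨α', hα⟩ := h.exists_extend (hY.pi_right n 0) α
  choose p' hp' using fun j => h.exists_extend (hY.pi_right a' 0) (f'.comp (p j))
  choose q' hq' using fun j => h'.exists_extend (hY'.pi_right a 0) (f.comp (q j))
  choose p'' hp'' using fun j => h.exists_desc (g'.comp (p' j)) (by
    rw [LinearMap.comp_assoc, hp', ← LinearMap.comp_assoc, h'.comp_eq_zero, LinearMap.zero_comp])
  choose q'' hq'' using fun j => h'.exists_desc (g.comp (q' j)) (by
    rw [LinearMap.comp_assoc, hq', ← LinearMap.comp_assoc, h.comp_eq_zero, LinearMap.zero_comp])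
  have hα1 : ∀ x, α' (f x) = α x := LinearMap.congr_fun hα
  have hp1 : ∀ j x, p' j (f x) = f' (p j x) := fun j => LinearMap.congr_fun (hp' j)
  have hq1 : ∀ j x, q' j (f' x) = f (q j x) := fun j => LinearMap.congr_fun (hq' j)
  have hp2 : ∀ j x, p'' j (g x) = g' (p' j x) := fun j => LinearMap.congr_fun (hp'' j)
  have hq2 : ∀ j x, q'' j (g' x) = g (q' j x) := fun j => LinearMap.congr_fun (hq'' j)
  have h1 : ∀ x, β (α x) + ∑ j, q j (p j x) = x := fun x => by
    simpa using LinearMap.congr_fun hcd x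
  obtain ⟨t, ht⟩ := h.exists_desc
    (LinearMap.id - f.comp (β.comp α') - ∑ j, (q' j).comp (p' j)) (by
      refine LinearMap.ext fun x => ?_
      simp only [LinearMap.comp_apply, LinearMap.sub_apply, LinearMap.sum_apply,
        LinearMap.id_apply, LinearMap.zero_apply, hα1, hp1, hq1]
      rw [← map_sum, ← map_sub, ← map_sub, sub_sub, h1, sub_self, map_zero])
  refine ⟨g.comp t, ∑ j, (q'' j).comp (p'' j), fac_comp_pi g t,
    Fac.sum _ fun j _ => fac_comp _ _, ?_⟩
  refine LinearMap.ext fun y => ?_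
  obtain ⟨x, rfl⟩ := h.surj y
  have h2 : t (g x) = x - f (β (α' x)) - ∑ j, q' j (p' j x) := by
    simpa using LinearMap.congr_fun ht x
  simp only [LinearMap.add_apply, LinearMap.comp_apply, LinearMap.sum_apply, h2, hp2, hq2, map_sub,
    map_sum, h.exact.apply_apply_eq_zero, Module.End.one_apply]
  abel

lemma Level.exists_decomposition (k : Type u) [Field k] [Algebra k B] [Module.Finite k B]
    [IsNoetherianRing B] [IsArtinianRing B] [Module.Finite B M] (r : ℕ) :
    ∀ Y Y' : ModuleCat.{u} B, Level B M r Y → Level B M r Y' →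
      ∃ c d : Module.End B Y, Fac M c ∧ Fac Y' d ∧ c + d = 1 := by
  induction r with
  | zero =>
    rintro Y Y' ⟨_, hG, htr⟩ ⟨_, hG', htr'⟩
    exact TiltingComplements.exists_decomposition k hG.mm hG'.my hG'.ym hG'.yy hG'.gen hG.fpd
      hG.my (hG'.orth k htr' hG.my) hG.ym (hG.orth k htr hG'.my)
  | succ r ih =>
    rintro Y Y' ⟨_, hG, K, ⟨a, f, g, h⟩, hL⟩ ⟨_, hG', K', ⟨a', f', g', h'⟩, hL'⟩
    obtain ⟨c, d, hc, hd, hcd⟩ := ih K K' hL hL'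
    exact h.decomposition_up h' hG.ym hG'.ym hc hd hcd

lemma nonempty_linearEquiv_of_decomposition [IsNoetherianRing B] [IsArtinianRing B]
    {M Y Y' : ModuleCat.{u} B} (hY : IsComplement M Y) (hY' : IsComplement M Y')
    {c d : Module.End B Y} (hc : Fac M c) (hd : Fac Y' d) (hcd : c + d = 1) :
    Nonempty (Y ≃ₗ[B] Y') := by
  have _ := hY.1
  have hG := Good.of_isComplement hY
  have := hG.nontrivial
  have := isLocalRing_of_isNilpotent_or_isUnit hG.isNilpotent_or_isUnit
  obtain ⟨s, p, q, rfl⟩ := hd.exists_sum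
  have h1 : IsUnit (∑ j, stableMk B Y M ((q j).comp (p j))) := by
    have h2 : stableMk B Y M (∑ j, (q j).comp (p j)) = 1 := by
      rw [stableMk_eq_one_iff, ← hcd, add_sub_cancel_right]
      exact hc
    rw [← map_sum, h2]
    exact isUnit_one
  obtain ⟨j, hj⟩ : ∃ j, IsUnit (stableMk B Y M ((q j).comp (p j))) := by
    obtain ⟨j, -, hj⟩ := IsLocalRing.exists_of_isUnit_sum h1
    exact ⟨j, hj⟩
  have hu : IsUnit ((q j).comp (p j) : Module.End B Y) := by
    refine (TiltingComplements.isNilpotent_or_isUnit (RingHom.id (Module.End B Y))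
      (idempotent_of_isIndec hY.2.1) _).resolve_left fun hn => ?_
    exact (hn.map (stableMk B Y M)).not_isUnit hj
  obtain ⟨v, hv⟩ := hu.exists_left_inv
  have hv1 : ∀ x, v (q j (p j x)) = x := LinearMap.congr_fun hv
  rcases idempotent_of_isIndec hY'.2.1 ((p j).comp (v.comp (q j))) (by
    refine LinearMap.ext fun x => ?_
    change p j (v (q j (p j (v (q j x))))) = p j (v (q j x))
    rw [hv1]) with h | h
  · exfalso
    have _ := hY.2.1.1
    obtain ⟨x, hx⟩ := exists_ne (0 : Y)
    apply hx
    have h2 : p j (v (q j (p j x))) = 0 := LinearMap.congr_fun h (p j x)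
    rw [hv1] at h2
    rw [← hv1 x, h2, map_zero, map_zero]
  · exact ⟨LinearEquiv.ofLinearMap (p j) (v.comp (q j)) h hv⟩

/-- If `Ext^(d+1)` vanishes between finitely generated modules of finite projective dimension and
finitely generated modules, a module has at most `d + 1` indecomposable tilting complements. -/
theorem exists_complements (k : Type u) [Field k] [Algebra k B] [Module.Finite k B]
    [IsNoetherianRing B] [IsArtinianRing B] (M : ModuleCat.{u} B) (hM : Module.Finite B M) (d : ℕ)
    (hd : ∀ (Y W : Type u) [AddCommGroup Y] [Module B Y] [Module.Finite B Y] [AddCommGroup W]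
      [Module B W] [Module.Finite B W], FPD B Y → ExtVanish B Y W (d + 1)) :
    ∃ (m : ℕ) (N : Fin m → ModuleCat.{u} B), m ≤ d + 1 ∧
      (∀ i j, i ≠ j → IsEmpty (N i ≃ₗ[B] N j)) ∧ (∀ i, IsComplement M (N i)) ∧
      (∀ X : ModuleCat.{u} B, IsComplement M X → ∃ i, Nonempty (X ≃ₗ[B] N i)) := by
  classical
  let S : Setoid {X : ModuleCat.{u} B // IsComplement M X} :=
    { r := fun X X' => Nonempty (X.1 ≃ₗ[B] X'.1)
      iseqv := ⟨fun _ => ⟨LinearEquiv.refl _ _⟩, fun ⟨e⟩ => ⟨e.symm⟩,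
        fun ⟨e⟩ ⟨e'⟩ => ⟨e.trans e'⟩⟩ }
  have hlev : ∀ X : Quotient S, ∃ r : Fin (d + 1), Level B M r X.out.1 := by
    intro X
    obtain ⟨r, hr, hL⟩ := Good.exists_level k d X.out.1 X.out.2.1
      (Good.of_isComplement X.out.2) fun W _ _ _ _ =>
        have := X.out.2.1
        hd _ W (Good.of_isComplement X.out.2).fpd
    exact ⟨⟨r, by omega⟩, hL⟩
  choose l hl using hlev
  have hinj : Function.Injective l := by
    intro X X' h
    obtain ⟨c, e, hc, he, hce⟩ := Level.exists_decomposition k _ _ _ (hl X) (h ▸ hl X')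
    rw [← Quotient.out_eq X, ← Quotient.out_eq X']
    exact Quotient.sound (nonempty_linearEquiv_of_decomposition X.out.2 X'.out.2 hc he hce)
  have hfin : Finite (Quotient S) := Finite.of_injective l hinj
  let E := Finite.equivFin (Quotient S)
  refine ⟨Nat.card (Quotient S), fun i => (E.symm i).out.1, ?_, fun i j hij => ⟨fun e => hij ?_⟩,
    fun i => (E.symm i).out.2, fun X hX => ⟨E (Quotient.mk S ⟨X, hX⟩), ?_⟩⟩
  · simpa using Nat.card_le_card_of_injective l hinj
  · apply E.symm.injective
    rw [← Quotient.out_eq (E.symm i), ← Quotient.out_eq (E.symm j)]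
    exact Quotient.sound ⟨e⟩
  · beta_reduce
    rw [E.symm_apply_apply]
    exact Quotient.exact (Quotient.out_eq (Quotient.mk S ⟨X, hX⟩)).symm

end Levels

end TiltingComplements

namespace TiltingComplements

section GentleAlgebra

variable (k : Type u) [Field k] (Q : GentleQuiverData.{u})

/-- The idempotent of a gentle algebra attached to a vertex. -/
def vertex (v : Q.V) : GentleAlg k Q :=
  RingQuot.mkAlgHom k (GentleRel k Q) (FreeAlgebra.ι k (Sum.inl v))

/-- The element of a gentle algebra attached to an arrow. -/
def arrow (a : Q.E) : GentleAlg k Q :=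
  RingQuot.mkAlgHom k (GentleRel k Q) (FreeAlgebra.ι k (Sum.inr a))

lemma vertex_mul_self (v : Q.V) : vertex k Q v * vertex k Q v = vertex k Q v := by
  rw [vertex, ← map_mul, RingQuot.mkAlgHom_rel k (GentleRel.idem v)]

lemma vertex_mul_of_ne {v w : Q.V} (h : v ≠ w) : vertex k Q v * vertex k Q w = 0 := by
  rw [vertex, vertex, ← map_mul, RingQuot.mkAlgHom_rel k (GentleRel.orth v w h), map_zero]

lemma sum_vertex : ∑ v, vertex k Q v = 1 := by
  simp only [vertex]
  rw [← map_sum, RingQuot.mkAlgHom_rel k GentleRel.sum_idem, map_one]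

lemma src_mul_arrow (a : Q.E) : vertex k Q (Q.src a) * arrow k Q a = arrow k Q a := by
  rw [vertex, arrow, ← map_mul, RingQuot.mkAlgHom_rel k (GentleRel.src_mul a)]

lemma arrow_mul_tgt (a : Q.E) : arrow k Q a * vertex k Q (Q.tgt a) = arrow k Q a := by
  rw [vertex, arrow, ← map_mul, RingQuot.mkAlgHom_rel k (GentleRel.mul_tgt a)]

lemma arrow_mul_arrow_of_rel {a b : Q.E} (h : Q.rel a b) : arrow k Q a * arrow k Q b = 0 := by
  rw [arrow, arrow, ← map_mul, RingQuot.mkAlgHom_rel k (GentleRel.relation a b h), map_zero]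

lemma arrow_mul_arrow_of_ne {a b : Q.E} (h : Q.tgt a ≠ Q.src b) :
    arrow k Q a * arrow k Q b = 0 := by
  rw [← arrow_mul_tgt, ← src_mul_arrow k Q b, mul_assoc, ← mul_assoc (vertex k Q (Q.tgt a)),
    vertex_mul_of_ne k Q h, zero_mul, mul_zero]

variable {k Q}

lemma gentle_induction {P : GentleAlg k Q → Prop} (hscalar : ∀ c : k, P (algebraMap k _ c))
    (hvertex : ∀ v, P (vertex k Q v)) (harrow : ∀ a, P (arrow k Q a))
    (hmul : ∀ x y, P x → P y → P (x * y)) (hadd : ∀ x y, P x → P y → P (x + y))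
    (x : GentleAlg k Q) : P x := by
  obtain ⟨y, rfl⟩ := RingQuot.mkAlgHom_surjective k (GentleRel k Q) x
  induction y using FreeAlgebra.induction with
  | grade0 r => rw [AlgHom.commutes]; exact hscalar r
  | grade1 s =>
    cases s with
    | inl v => exact hvertex v
    | inr a => exact harrow a
  | mul x y hx hy => rw [map_mul]; exact hmul _ _ hx hy
  | add x y hx hy => rw [map_add]; exact hadd _ _ hx hy

lemma exists_gentle_lift {S : Type*} [Ring S] [Algebra k S] (e : Q.V → S) (x : Q.E → S)
    (h1 : ∀ v, e v * e v = e v) (h2 : ∀ v w, v ≠ w → e v * e w = 0) (h3 : ∑ v, e v = 1)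
    (h4 : ∀ a, e (Q.src a) * x a = x a) (h5 : ∀ a, x a * e (Q.tgt a) = x a)
    (h6 : ∀ a b, Q.rel a b → x a * x b = 0) :
    ∃ ρ : GentleAlg k Q →ₐ[k] S, (∀ v, ρ (vertex k Q v) = e v) ∧
      ∀ a, ρ (arrow k Q a) = x a := by
  let F : FreeAlgebra k (Q.V ⊕ Q.E) →ₐ[k] S := FreeAlgebra.lift k (Sum.elim e x)
  have hv : ∀ v, F (FreeAlgebra.ι k (Sum.inl v)) = e v := fun v => by
    simp only [F, FreeAlgebra.lift_ι_apply, Sum.elim_inl]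
  have ha : ∀ a, F (FreeAlgebra.ι k (Sum.inr a)) = x a := fun a => by
    simp only [F, FreeAlgebra.lift_ι_apply, Sum.elim_inr]
  refine ⟨RingQuot.liftAlgHom k ⟨F, ?_⟩, fun v => ?_, fun a => ?_⟩
  · intro y z h
    cases h with
    | idem v => rw [map_mul, hv, h1]
    | orth v w h => rw [map_mul, hv, hv, h2 v w h, map_zero]
    | sum_idem => rw [map_sum, map_one, ← h3]; exact Finset.sum_congr rfl fun v _ => hv v
    | src_mul a => rw [map_mul, hv, ha, h4]
    | mul_tgt a => rw [map_mul, hv, ha, h5]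
    | relation a b h => rw [map_mul, ha, ha, h6 a b h, map_zero]
  · exact (RingQuot.liftAlgHom_mkAlgHom_apply _ _ _ _).trans (hv v)
  · exact (RingQuot.liftAlgHom_mkAlgHom_apply _ _ _ _).trans (ha a)

/-- A finite-dimensional gentle algebra has no infinite path avoiding the relations. -/
lemma not_exists_infinite_path [FiniteDimensional k (GentleAlg k Q)] (b : ℕ → Q.E)
    (hb : ∀ i, Q.tgt (b i) = Q.src (b (i + 1))) (hr : ∀ i, ¬ Q.rel (b i) (b (i + 1))) : False := by
  classical
  let e : Q.V → Module.End k (ℕ → k) := fun v =>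
    { toFun := fun f i => if Q.src (b i) = v then f i else 0
      map_add' := fun f g => by ext i; by_cases h : Q.src (b i) = v <;> simp [h]
      map_smul' := fun c f => by ext i; by_cases h : Q.src (b i) = v <;> simp [h] }
  let x : Q.E → Module.End k (ℕ → k) := fun a =>
    { toFun := fun f i => if b i = a then f (i + 1) else 0
      map_add' := fun f g => by ext i; by_cases h : b i = a <;> simp [h]
      map_smul' := fun c f => by ext i; by_cases h : b i = a <;> simp [h] }
  have he : ∀ v f i, e v f i = if Q.src (b i) = v then f i else 0 := fun _ _ _ => rfl
  have hx : ∀ a f i, x a f i = if b i = a then f (i + 1) else 0 := fun _ _ _ => rfl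
  obtain ⟨ρ, -, hρ⟩ := exists_gentle_lift (k := k) (Q := Q) e x
    (fun v => LinearMap.ext fun f => funext fun i => by
      rw [Module.End.mul_apply, he, he]; split_ifs <;> rfl)
    (fun v w h => LinearMap.ext fun f => funext fun i => by
      rw [Module.End.mul_apply, he, he]
      split_ifs with h1 h2
      · exact absurd (h1.symm.trans h2) h
      all_goals rfl)
    (LinearMap.ext fun f => funext fun i => by
      rw [LinearMap.sum_apply, Finset.sum_apply]
      simp only [he]
      rw [Finset.sum_ite_eq, if_pos (Finset.mem_univ _)]; rfl)
    (fun a => LinearMap.ext fun f => funext fun i => by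
      rw [Module.End.mul_apply, he, hx]
      split_ifs with h1 h2 h2
      · rfl
      · rfl
      · exact absurd (congrArg Q.src h2) h1
      · rfl)
    (fun a => LinearMap.ext fun f => funext fun i => by
      rw [Module.End.mul_apply, hx, hx, he]
      split_ifs with h1 h2
      · rfl
      · exact absurd (h1 ▸ (hb i).symm) h2
      · rfl)
    (fun a c h => LinearMap.ext fun f => funext fun i => by
      rw [Module.End.mul_apply, hx, hx]
      split_ifs with h1 h2
      · exact absurd (h1 ▸ h2 ▸ h) (hr i)
      all_goals rfl)
  let p : ℕ → GentleAlg k Q := fun n => Nat.rec 1 (fun n y => y * arrow k Q (b n)) n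
  have hp : ∀ (n : ℕ) (f : ℕ → k), ρ (p n) f 0 = f n := by
    intro n
    induction n with
    | zero => intro f; change ρ 1 f 0 = f 0; rw [map_one]; rfl
    | succ n ih =>
      intro f
      change ρ (p n * arrow k Q (b n)) f 0 = f (n + 1)
      rw [map_mul, Module.End.mul_apply, ih, hρ, hx, if_pos rfl]
  have hli : LinearIndependent k p := by
    rw [linearIndependent_iff']
    intro s c hc i hi
    have h := congrArg (fun y => ρ y (Pi.single i 1) 0) hc
    simp only [map_sum, map_smul, LinearMap.sum_apply, Finset.sum_apply, LinearMap.smul_apply,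
      Pi.smul_apply, hp, map_zero, LinearMap.zero_apply, Pi.zero_apply, smul_eq_mul] at h
    rw [Finset.sum_eq_single i] at h
    · simpa using h
    · intro j _ hj
      rw [Pi.single_eq_of_ne hj, mul_zero]
    · exact fun h' => absurd hi h'
  exact not_finite_iff_infinite.2 inferInstance hli.finite

lemma card_arrows_lt [FiniteDimensional k (GentleAlg k Q)] [Nonempty Q.V] :
    Fintype.card Q.E < 2 * Fintype.card Q.V := by
  classical
  have hfib : ∀ v, (Finset.univ.filter fun a : Q.E => Q.src a = v).card ≤ 2 := fun v => by
    have := Q.src_le_two v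
    rwa [Set.ncard_eq_toFinset_card', Set.toFinset_ofPred] at this
  have hcard : Fintype.card Q.E =
      ∑ v : Q.V, (Finset.univ.filter fun a : Q.E => Q.src a = v).card :=
    Finset.card_eq_sum_card_fiberwise fun a _ => Finset.mem_univ _
  by_contra hlt
  have heq : ∀ v, (Finset.univ.filter fun a : Q.E => Q.src a = v).card = 2 := by
    have h2 : ∑ v : Q.V, (Finset.univ.filter fun a : Q.E => Q.src a = v).card =
        ∑ _v : Q.V, 2 := by
      refine le_antisymm (Finset.sum_le_sum fun v _ => hfib v) ?_
      rw [← hcard, Finset.sum_const, Finset.card_univ, smul_eq_mul, mul_comm]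
      exact not_lt.1 hlt
    exact fun v => (Finset.sum_eq_sum_iff_of_le fun v _ => hfib v).1 h2 v (Finset.mem_univ v)
  have hnext : ∀ a : Q.E, ∃ b, Q.tgt a = Q.src b ∧ ¬ Q.rel a b := by
    intro a
    obtain ⟨b, c, hbc, h⟩ := Finset.card_eq_two.1 (heq (Q.tgt a))
    have hb : Q.src b = Q.tgt a := by
      have : b ∈ Finset.univ.filter fun a' : Q.E => Q.src a' = Q.tgt a := by simp [h]
      simpa using this
    have hc : Q.src c = Q.tgt a := by
      have : c ∈ Finset.univ.filter fun a' : Q.E => Q.src a' = Q.tgt a := by simp [h]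
      simpa using this
    by_cases hr : Q.rel a b
    · exact ⟨c, hc.symm, fun hr' => hbc (Q.rel_right_unique a b c hr hr')⟩
    · exact ⟨b, hb.symm, hr⟩
  choose next hn1 hn2 using hnext
  obtain ⟨a⟩ : Nonempty Q.E := by
    obtain ⟨v⟩ := ‹Nonempty Q.V›
    have : 0 < (Finset.univ.filter fun a : Q.E => Q.src a = v).card := by rw [heq]; norm_num
    obtain ⟨a, -⟩ := Finset.card_pos.1 this
    exact ⟨a⟩
  refine not_exists_infinite_path (k := k) (fun i => next^[i] a) (fun i => ?_) fun i => ?_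
  · rw [Function.iterate_succ_apply']; exact hn1 _
  · rw [Function.iterate_succ_apply']; exact hn2 _

lemma smul_vertex_smul_eq_zero {R : Type*} [AddCommGroup R] [Module (GentleAlg k Q) R]
    [Module k R] [IsScalarTower k (GentleAlg k Q) R] (y : Q.E → GentleAlg k Q)
    (hy : ∑ a, y a * arrow k Q a = 0) (a : Q.E) (r : R)
    (hr : ∀ b, Q.rel b a → arrow k Q b • r = 0) :
    y a • vertex k Q (Q.src a) • r = 0 := by
  classical
  have hc : ∀ (z : GentleAlg k Q) (c : k) (s : R), z • c • s = c • z • s := fun z c s => by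
    rw [← algebraMap_smul (GentleAlg k Q) c s, ← algebraMap_smul (GentleAlg k Q) c (z • s),
      ← mul_smul, ← mul_smul, Algebra.commutes]
  let e : Q.V → Module.End k ((Q.V → k) × R) := fun v =>
    { toFun := fun p => (Pi.single v (p.1 v), vertex k Q v • p.2)
      map_add' := fun p q => by simp [Pi.single_add]
      map_smul' := fun c p => by
        refine Prod.ext ?_ (hc _ _ _)
        exact Pi.single_smul (f := fun _ => k) v c (p.1 v) }
  let x : Q.E → Module.End k ((Q.V → k) × R) := fun c =>
    { toFun := fun p => (0, arrow k Q c • p.2 +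
        if a = c then p.1 (Q.tgt c) • vertex k Q (Q.src c) • r else 0)
      map_add' := fun p q => by
        refine Prod.ext (by simp) ?_
        by_cases h : a = c
        · simp only [if_pos h, Prod.fst_add, Prod.snd_add, Pi.add_apply, smul_add, add_smul]
          abel
        · simp [h]
      map_smul' := fun d p => by
        refine Prod.ext (by simp) ?_
        by_cases h : a = c
        · simp only [if_pos h, Prod.smul_fst, Prod.smul_snd, Pi.smul_apply, smul_add, hc,
            RingHom.id_apply, smul_assoc]
        · simp [h, hc] }
  have he : ∀ v p, e v p = (Pi.single v (p.1 v), vertex k Q v • p.2) := fun _ _ => rfl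
  have hx : ∀ c p, x c p = (0, arrow k Q c • p.2 +
    if a = c then p.1 (Q.tgt c) • vertex k Q (Q.src c) • r else 0) := fun _ _ => rfl
  obtain ⟨ρ, hv, ha⟩ := exists_gentle_lift (k := k) (Q := Q) e x
    (fun v => LinearMap.ext fun p => by
      rw [Module.End.mul_apply, he, he]
      simp only [Pi.single_eq_same, ← mul_smul, vertex_mul_self])
    (fun v w h => LinearMap.ext fun p => by
      rw [Module.End.mul_apply, he, he]
      simp only [Pi.single_eq_of_ne h, Pi.single_zero, ← mul_smul, vertex_mul_of_ne k Q h,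
        zero_smul]
      rfl)
    (LinearMap.ext fun p => by
      rw [LinearMap.sum_apply]
      simp only [he]
      refine Prod.ext ?_ ?_
      · rw [Prod.fst_sum]
        exact Finset.univ_sum_single p.1
      · rw [Prod.snd_sum]
        simp only
        rw [← Finset.sum_smul, sum_vertex, one_smul]; rfl)
    (fun c => LinearMap.ext fun p => by
      rw [Module.End.mul_apply, he, hx]
      refine Prod.ext (by simp) ?_
      simp only [smul_add, ← mul_smul, src_mul_arrow]
      split_ifs
      · rw [hc, ← mul_smul, vertex_mul_self]
      · rw [smul_zero])
    (fun c => LinearMap.ext fun p => by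
      rw [Module.End.mul_apply, hx, hx, he]
      simp only [Pi.single_eq_same, ← mul_smul, arrow_mul_tgt])
    (fun c d h => LinearMap.ext fun p => by
      rw [Module.End.mul_apply, hx, hx]
      refine Prod.ext rfl ?_
      simp only [smul_add, ← mul_smul, arrow_mul_arrow_of_rel k Q h, zero_smul, Pi.zero_apply,
        ite_self, add_zero, zero_add, LinearMap.zero_apply, Prod.snd_zero]
      split_ifs with h1
      · subst h1
        rw [hc, ← mul_smul, ← Q.rel_comp c a h, arrow_mul_tgt, hr c h, smul_zero]
      · rw [smul_zero])
  have hact : ∀ (z : GentleAlg k Q) (s : R), ρ z (0, s) = (0, z • s) := by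
    intro z
    refine gentle_induction (P := fun z => ∀ s : R, ρ z (0, s) = (0, z • s)) ?_ ?_ ?_ ?_ ?_ z
    · intro c s
      rw [AlgHom.commutes, Module.algebraMap_end_apply, algebraMap_smul]
      simp
    · intro v s
      rw [hv, he]; simp
    · intro c s
      rw [ha, hx]; simp
    · intro z w hz hw s
      rw [map_mul, Module.End.mul_apply, hw, hz, mul_smul]
    · intro z w hz hw s
      rw [map_add, LinearMap.add_apply, hw, hz, add_smul]; simp
  have h := congrArg (fun z => (ρ z (1, 0)).2) hy
  simp only [map_sum, map_mul, LinearMap.sum_apply, Module.End.mul_apply, Prod.snd_sum, ha, hx,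
    hact, map_zero, LinearMap.zero_apply, Prod.snd_zero, smul_zero, zero_add, smul_ite,
    Pi.one_apply, one_smul] at h
  rwa [Finset.sum_ite_eq, if_pos (Finset.mem_univ a)] at h

/-- The relations between the arrows, as elements of the regular left module. -/
lemma mul_vertex_mem_of_sum_mul_arrow_eq_zero (y : Q.E → GentleAlg k Q)
    (hy : ∑ a, y a * arrow k Q a = 0) (a : Q.E) :
    y a * vertex k Q (Q.src a) ∈
      Submodule.span (GentleAlg k Q) {z | ∃ b, Q.rel b a ∧ z = arrow k Q b} := by
  set L := Submodule.span (GentleAlg k Q) {z | ∃ b, Q.rel b a ∧ z = arrow k Q b}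
  have h := smul_vertex_smul_eq_zero y hy a (L.mkQ 1) fun b hb => by
    rw [← map_smul, smul_eq_mul, mul_one]
    exact (Submodule.Quotient.mk_eq_zero L).2 (Submodule.subset_span ⟨b, hb, rfl⟩)
  rw [← map_smul, ← map_smul, smul_eq_mul, smul_eq_mul, mul_one] at h
  exact (Submodule.Quotient.mk_eq_zero L).1 h

end GentleAlgebra

end TiltingComplements

namespace TiltingComplements

section Cosyzygy

open MulOpposite

/-- The endomorphism `φ ↦ φ (b * ·)` of the dual of the regular module. -/
def KDual.mulMap {k : Type u} [Field k] {B : Type u} [Ring B] [Algebra k B] (b : B) :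
    KDual k B →ₗ[B] KDual k B where
  toFun φ := KDual.mk (φ.toLin.comp (LinearMap.mulLeft k b))
  map_add' _ _ := rfl
  map_smul' c φ := KDual.ext fun x => congrArg φ (mul_assoc b x c)

lemma KDual.mulMap_apply {k : Type u} [Field k] {B : Type u} [Ring B] [Algebra k B] (b : B)
    (φ : KDual k B) (x : B) : KDual.mulMap b φ x = φ (b * x) := rfl

variable {k : Type u} [Field k] {Q : GentleQuiverData.{u}}

/-- The dual of the regular left module of a gentle algebra, as a right module. -/
abbrev Cogen (k : Type u) [Field k] (Q : GentleQuiverData.{u}) : Type u :=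
  KDual k (GentleAlg k Q)ᵐᵒᵖ

/-- The indecomposable injective module attached to a vertex. -/
def vertexInjective (k : Type u) [Field k] (Q : GentleQuiverData.{u}) (v : Q.V) :
    Submodule (GentleAlg k Q)ᵐᵒᵖ (Cogen k Q) :=
  LinearMap.eqLocus (KDual.mulMap (op (vertex k Q v))) LinearMap.id

lemma mem_vertexInjective {v : Q.V} {φ : Cogen k Q} :
    φ ∈ vertexInjective k Q v ↔ ∀ z, φ (op (z * vertex k Q v)) = φ (op z) :=
  ⟨fun h z => DFunLike.congr_fun h (op z), fun h => KDual.ext fun z => h z.unop⟩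

/-- The submodule of the dual of the regular module dual to the left ideal generated by
an arrow. -/
def arrowDual (k : Type u) [Field k] (Q : GentleQuiverData.{u}) (a : Q.E) :
    Submodule (GentleAlg k Q)ᵐᵒᵖ (Cogen k Q) :=
  vertexInjective k Q (Q.src a) ⊓
    ⨅ b : {b // Q.rel b a}, LinearMap.ker (KDual.mulMap (op (arrow k Q b)))

lemma mem_arrowDual {a : Q.E} {φ : Cogen k Q} :
    φ ∈ arrowDual k Q a ↔ (∀ z, φ (op (z * vertex k Q (Q.src a))) = φ (op z)) ∧
      ∀ b, Q.rel b a → ∀ z, φ (op (z * arrow k Q b)) = 0 := by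
  rw [arrowDual, Submodule.mem_inf, mem_vertexInjective, Submodule.mem_iInf]
  refine and_congr_right fun _ => ⟨fun h b hb z => ?_, fun h b => KDual.ext fun z => ?_⟩
  · exact DFunLike.congr_fun (LinearMap.mem_ker.1 (h ⟨b, hb⟩)) (op z)
  · exact h b b.2 z.unop

/-- The map `φ ↦ φ (· * a)` from the dual of the regular module. -/
def toArrowDual (k : Type u) [Field k] (Q : GentleQuiverData.{u}) (a : Q.E) :
    Cogen k Q →ₗ[(GentleAlg k Q)ᵐᵒᵖ] arrowDual k Q a :=
  (KDual.mulMap (op (arrow k Q a))).codRestrict (arrowDual k Q a) fun φ =>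
    mem_arrowDual.2 ⟨fun z => by
      rw [KDual.mulMap_apply, KDual.mulMap_apply, ← op_mul, ← op_mul, mul_assoc, src_mul_arrow],
    fun b hb z => by
      rw [KDual.mulMap_apply, ← op_mul, mul_assoc, arrow_mul_arrow_of_rel k Q hb, mul_zero,
        op_zero, map_zero]⟩

lemma toArrowDual_eq_zero {a : Q.E} {φ : Cogen k Q} :
    toArrowDual k Q a φ = 0 ↔ ∀ z, φ (op (z * arrow k Q a)) = 0 :=
  ⟨fun h z => DFunLike.congr_fun (congrArg Subtype.val h) (op z),
    fun h => Subtype.ext (KDual.ext fun z => h z.unop)⟩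

lemma arrowDual_apply_eq_zero {a : Q.E} {φ : Cogen k Q} (hφ : φ ∈ arrowDual k Q a)
    {y : GentleAlg k Q} (hy : y * vertex k Q (Q.src a) ∈
      Submodule.span (GentleAlg k Q) {z | ∃ b, Q.rel b a ∧ z = arrow k Q b}) :
    φ (op y) = 0 := by
  rw [mem_arrowDual] at hφ
  rw [← hφ.1]
  have h : ∀ w ∈ Submodule.span (GentleAlg k Q) {z | ∃ b, Q.rel b a ∧ z = arrow k Q b},
      ∀ z, φ (op (z * w)) = 0 := by
    intro w hw
    induction hw using Submodule.span_induction with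
    | mem w hw => obtain ⟨b, hb, rfl⟩ := hw; exact hφ.2 b hb
    | zero => intro z; rw [mul_zero, op_zero, map_zero]
    | add v w _ _ hv hw => intro z; rw [mul_add, MulOpposite.op_add, map_add, hv, hw, add_zero]
    | smul c w _ hw => intro z; rw [smul_eq_mul, ← mul_assoc]; exact hw _
  simpa using h _ hy 1

lemma pi_toArrowDual_surjective :
    Function.Surjective (LinearMap.pi fun a => toArrowDual k Q a) := by
  intro ψ
  let Φ : (Q.E → GentleAlg k Q) →ₗ[k] GentleAlg k Q :=
    ∑ a, (LinearMap.mulRight k (arrow k Q a)).comp (LinearMap.proj a)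
  let Ψ : (Q.E → GentleAlg k Q) →ₗ[k] k :=
    ∑ a, ((ψ a : Cogen k Q).toLin.comp (opLinearEquiv k).toLinearMap).comp (LinearMap.proj a)
  have hΦ : ∀ y, Φ y = ∑ a, y a * arrow k Q a := fun y => LinearMap.sum_apply _ _ _
  have hΨ : ∀ y, Ψ y = ∑ a, (ψ a : Cogen k Q) (op (y a)) := fun y => LinearMap.sum_apply _ _ _
  have hmem : Ψ ∈ LinearMap.range Φ.dualMap := by
    rw [LinearMap.range_dualMap_eq_dualAnnihilator_ker, Submodule.mem_dualAnnihilator]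
    intro y hy
    rw [LinearMap.mem_ker, hΦ] at hy
    rw [hΨ]
    exact Finset.sum_eq_zero fun a _ => arrowDual_apply_eq_zero (ψ a).2
      (mul_vertex_mem_of_sum_mul_arrow_eq_zero y hy a)
  obtain ⟨l, hl⟩ := hmem
  refine ⟨KDual.mk (l.comp (opLinearEquiv k).symm.toLinearMap), ?_⟩
  classical
  refine funext fun a => Subtype.ext (KDual.ext fun z => ?_)
  have h := LinearMap.congr_fun hl (Pi.single a z.unop)
  rw [LinearMap.dualMap_apply, hΦ, hΨ] at h
  rw [Finset.sum_eq_single a (fun b _ hb => by rw [Pi.single_eq_of_ne hb, zero_mul])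
    fun h => absurd (Finset.mem_univ a) h,
    Finset.sum_eq_single a (fun b _ hb => by rw [Pi.single_eq_of_ne hb, op_zero, map_zero])
    fun h => absurd (Finset.mem_univ a) h, Pi.single_eq_same] at h
  exact h

lemma isShortExact_arrowDual :
    IsShortExact (LinearMap.ker (LinearMap.pi fun a => toArrowDual k Q a)).subtype
      (LinearMap.pi fun a => toArrowDual k Q a) :=
  isShortExact_ker _ pi_toArrowDual_surjective

lemma isShortExact_arrowDual_of_rel {a b : Q.E} (h : Q.rel b a) :
    IsShortExact (Submodule.inclusion (inf_le_left : arrowDual k Q a ≤ _))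
      ((toArrowDual k Q b).comp (vertexInjective k Q (Q.src a)).subtype) := by
  refine ⟨Submodule.inclusion_injective _, fun φ => ?_, fun χ => ?_⟩
  · rw [LinearMap.comp_apply, Submodule.subtype_apply, toArrowDual_eq_zero, Set.mem_range]
    refine ⟨fun h' => ⟨⟨φ, mem_arrowDual.2 ⟨mem_vertexInjective.1 φ.2, fun c hc => ?_⟩⟩, rfl⟩, ?_⟩
    · rwa [Q.rel_left_unique a c b hc h]
    · rintro ⟨ψ, rfl⟩
      exact (mem_arrowDual.1 ψ.2).2 b h
  · classical
    obtain ⟨φ, hφ⟩ := pi_toArrowDual_surjective (k := k) (Q := Q) (Pi.single b χ)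
    refine ⟨⟨KDual.mulMap (op (vertex k Q (Q.src a))) φ, mem_vertexInjective.2 fun z => ?_⟩, ?_⟩
    · rw [KDual.mulMap_apply, KDual.mulMap_apply, ← op_mul, ← op_mul, mul_assoc, vertex_mul_self]
    · have hb := congrFun hφ b
      rw [Pi.single_eq_same] at hb
      rw [← hb]
      refine Subtype.ext (KDual.ext fun z => ?_)
      change φ (op (z.unop * arrow k Q b * vertex k Q (Q.src a))) = φ (op (z.unop * arrow k Q b))
      rw [mul_assoc, ← Q.rel_comp b a h, arrow_mul_tgt]

variable {Y : Type u} [AddCommGroup Y] [Module (GentleAlg k Q)ᵐᵒᵖ Y]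

lemma extVanish_vertexInjective (v : Q.V) (i : ℕ) :
    ExtVanish (GentleAlg k Q)ᵐᵒᵖ Y (vertexInjective k Q v) (i + 1) := by
  refine extVanish_retract_right (Z := Cogen k Q) (vertexInjective k Q v).subtype
    ((KDual.mulMap (op (vertex k Q v))).codRestrict _ fun φ => mem_vertexInjective.2 fun z => ?_)
    (LinearMap.ext fun φ => Subtype.ext φ.2) (extVanish_of_injective i)
  rw [KDual.mulMap_apply, KDual.mulMap_apply, ← op_mul, ← op_mul, mul_assoc, vertex_mul_self]

/-- The property of having nonzero Ext into `arrowDual` propagates along relations. -/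
lemma exists_rel_of_not_extVanish {a : Q.E} {i : ℕ}
    (h : ¬ ExtVanish (GentleAlg k Q)ᵐᵒᵖ Y (arrowDual k Q a) (i + 1)) :
    ∃ b, Q.rel b a ∧ ¬ ExtVanish (GentleAlg k Q)ᵐᵒᵖ Y (arrowDual k Q b) i := by
  by_contra! hb
  refine h ?_
  by_cases hr : ∃ b, Q.rel b a
  · obtain ⟨b, hba⟩ := hr
    exact (isShortExact_arrowDual_of_rel hba).extVanish_left (hb b hba)
      (extVanish_vertexInjective _ i)
  · have heq : arrowDual k Q a = vertexInjective k Q (Q.src a) :=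
      le_antisymm inf_le_left fun φ hφ => mem_arrowDual.2
        ⟨mem_vertexInjective.1 hφ, fun b hb => absurd ⟨b, hb⟩ hr⟩
    rw [heq]
    exact extVanish_vertexInjective _ i

lemma extVanish_of_rel {a b : Q.E} (hba : Q.rel b a) {i : ℕ}
    (h : ExtVanish (GentleAlg k Q)ᵐᵒᵖ Y (arrowDual k Q a) (i + 1 + 1)) :
    ExtVanish (GentleAlg k Q)ᵐᵒᵖ Y (arrowDual k Q b) (i + 1) :=
  (isShortExact_arrowDual_of_rel hba).extVanish_right (extVanish_vertexInjective _ i) h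

end Cosyzygy

end TiltingComplements

namespace TiltingComplements

section Propagation

variable {E : Type*} {rel : E → E → Prop} {p : ℕ → E → Prop}

lemma exists_chain (h : ∀ i a, p (i + 1) a → ∃ b, rel b a ∧ p i b) (j : ℕ) : ∀ a, p j a →
    ∃ c : ℕ → E, (∀ i ≤ j, p i (c i)) ∧ ∀ i < j, rel (c i) (c (i + 1)) := by
  suffices H : ∀ a, p j a →
      ∃ c : ℕ → E, (∀ i ≤ j, p i (c i)) ∧ (∀ i < j, rel (c i) (c (i + 1))) ∧ c j = a by
    intro a ha
    obtain ⟨c, h1, h2, -⟩ := H a ha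
    exact ⟨c, h1, h2⟩
  induction j with
  | zero =>
    intro a ha
    refine ⟨fun _ => a, fun i hi => ?_, fun i hi => absurd hi (Nat.not_lt_zero i), rfl⟩
    rwa [Nat.le_zero.1 hi]
  | succ j ih =>
    intro a ha
    obtain ⟨b, hba, hb⟩ := h j a ha
    obtain ⟨c, h1, h2, h3⟩ := ih b hb
    refine ⟨fun i => if i ≤ j then c i else a, fun i hi => ?_, fun i hi => ?_, by simp⟩
    · by_cases hij : i ≤ j
      · simpa [hij] using h1 i hij
      · obtain rfl : i = j + 1 := by omega
        simpa using ha
    · by_cases hij : i < j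
      · simpa [hij.le, Nat.succ_le_of_lt hij] using h2 i hij
      · obtain rfl : i = j := by omega
        simpa [h3] using hba

/-- A property which can be traced back along a relation, propagates forward along it, and
eventually fails, already fails after as many steps as there are elements. -/
lemma not_of_card_le [Fintype E] (h1 : ∀ i a, p (i + 1) a → ∃ b, rel b a ∧ p i b)
    (h2 : ∀ i a b, rel b a → p (i + 1) b → p (i + 1 + 1) a)
    (h3 : ∃ D, ∀ i, D < i → ∀ a, ¬ p i a) {j : ℕ} (hj : Fintype.card E ≤ j) (a : E) :
    ¬ p j a := by
  intro ha
  obtain ⟨c, hc, hr⟩ := exists_chain h1 j a ha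
  obtain ⟨s, t, hst, htj, hcst⟩ : ∃ s t, s < t ∧ t ≤ j ∧ c s = c t := by
    obtain ⟨s, t, hne, heq⟩ := Fintype.exists_ne_map_eq_of_card_lt
      (fun i : Fin (j + 1) => c i) (by rw [Fintype.card_fin]; omega)
    have hne' : (s : ℕ) ≠ t := fun h => hne (Fin.ext h)
    rcases lt_or_gt_of_ne hne' with h | h
    · exact ⟨s, t, h, by omega, heq⟩
    · exact ⟨t, s, h, by omega, heq.symm⟩
  have hup : ∀ i, p (i + 1) (c t) → ∀ r, s + r ≤ t → p (i + 1 + r) (c (s + r)) := by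
    intro i hi r
    induction r with
    | zero => intro _; simpa [hcst] using hi
    | succ r ih =>
      intro hle
      have := h2 (i + r) (c (s + r + 1)) (c (s + r)) (hr (s + r) (by omega))
        (by have := ih (by omega); rwa [Nat.add_right_comm] at this)
      rwa [show i + 1 + (r + 1) = i + r + 1 + 1 by omega]
  have hinf : ∀ m, ∃ i, m ≤ i ∧ p (i + 1) (c t) := by
    intro m
    induction m with
    | zero => exact ⟨t - 1, Nat.zero_le _, by rw [Nat.sub_add_cancel (by omega)]; exact hc t htj⟩
    | succ m ih =>
      obtain ⟨i, hmi, hi⟩ := ih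
      refine ⟨i + (t - s), by omega, ?_⟩
      have := hup i hi (t - s) (by omega)
      rwa [show s + (t - s) = t by omega, Nat.add_right_comm] at this
  obtain ⟨D, hD⟩ := h3
  obtain ⟨i, hDi, hi⟩ := hinf D
  exact hD (i + 1) (by omega) _ hi

end Propagation

section GlobalBound

lemma exists_isShortExact_comap_mkQ {B W : Type u} [Ring B] [AddCommGroup W] [Module B W]
    (N : Submodule B W) (K : Submodule B (W ⧸ N)) :
    ∃ (f : N →ₗ[B] K.comap N.mkQ) (g : K.comap N.mkQ →ₗ[B] K), IsShortExact f g := by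
  refine ⟨Submodule.inclusion (Submodule.le_comap_mkQ N K), N.mkQ.restrict fun x hx => hx,
    Submodule.inclusion_injective _, fun x => ⟨fun h => ?_, ?_⟩, fun x => ?_⟩
  · have : N.mkQ x = 0 := congrArg Subtype.val h
    exact ⟨⟨x, (Submodule.Quotient.mk_eq_zero N).1 this⟩, rfl⟩
  · rintro ⟨y, rfl⟩
    exact Subtype.ext ((Submodule.Quotient.mk_eq_zero N).2 y.2)
  · obtain ⟨y, hy⟩ := N.mkQ_surjective x
    exact ⟨⟨y, by rw [Submodule.mem_comap, hy]; exact x.2⟩, Subtype.ext hy⟩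

open MulOpposite

variable {k : Type u} [Field k] {Q : GentleQuiverData.{u}}

/-- Every nonzero right module over a finite-dimensional gentle algebra has a nonzero element
concentrated at a vertex and annihilated by all arrows. -/
lemma exists_socle_element [FiniteDimensional k (GentleAlg k Q)] (W : Type*) [AddCommGroup W]
    [Module (GentleAlg k Q)ᵐᵒᵖ W] [Nontrivial W] :
    ∃ (w : W) (v : Q.V), w ≠ 0 ∧ op (vertex k Q v) • w = w ∧
      ∀ a, op (arrow k Q a) • w = 0 := by
  by_contra! hcon
  let S := {q : W × Q.E // op (arrow k Q q.2) • q.1 ≠ 0}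
  have hnext : ∀ s : S, ∃ t : S, Q.tgt s.1.2 = Q.src t.1.2 ∧ ¬ Q.rel s.1.2 t.1.2 := by
    rintro ⟨⟨w, a⟩, h⟩
    obtain ⟨b, hb⟩ := hcon (op (arrow k Q a) • w) (Q.tgt a) h
      (by rw [← mul_smul, ← op_mul, arrow_mul_tgt])
    refine ⟨⟨⟨_, b⟩, hb⟩, ?_, fun hr => hb ?_⟩
    · by_contra hne
      refine hb ?_
      rw [← mul_smul, ← op_mul, arrow_mul_arrow_of_ne k Q hne, op_zero, zero_smul]
    · rw [← mul_smul, ← op_mul, arrow_mul_arrow_of_rel k Q hr, op_zero, zero_smul]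
  choose next hn1 hn2 using hnext
  obtain ⟨w, hw⟩ := exists_ne (0 : W)
  obtain ⟨v, hv⟩ : ∃ v, op (vertex k Q v) • w ≠ 0 := by
    by_contra! h
    refine hw ?_
    rw [← one_smul (GentleAlg k Q)ᵐᵒᵖ w, ← op_one, ← sum_vertex k Q, Finset.op_sum,
      Finset.sum_smul]
    exact Finset.sum_eq_zero fun v _ => h v
  obtain ⟨a, ha⟩ := hcon _ v hv (by rw [← mul_smul, ← op_mul, vertex_mul_self])
  let s₀ : S := ⟨⟨_, a⟩, ha⟩
  refine not_exists_infinite_path (k := k) (fun i => (next^[i] s₀).1.2) (fun i => ?_) fun i => ?_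
  · rw [Function.iterate_succ_apply']; exact hn1 _
  · rw [Function.iterate_succ_apply']; exact hn2 _

lemma exists_scalar_of_socle {K : Type*} [AddCommGroup K] [Module (GentleAlg k Q)ᵐᵒᵖ K]
    [Module k K] [IsScalarTower k (GentleAlg k Q)ᵐᵒᵖ K] {w : K} {v : Q.V}
    (hv : op (vertex k Q v) • w = w) (ha : ∀ a, op (arrow k Q a) • w = 0)
    (y : GentleAlg k Q) :
    ∃ c : k, op y • w = c • w ∧ y * vertex k Q v - c • vertex k Q v ∈
      Submodule.span (GentleAlg k Q) (Set.range (arrow k Q)) := by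
  refine gentle_induction (P := fun y => ∃ c : k, op y • w = c • w ∧
    y * vertex k Q v - c • vertex k Q v ∈
      Submodule.span (GentleAlg k Q) (Set.range (arrow k Q))) ?_ ?_ ?_ ?_ ?_ y
  · intro c
    refine ⟨c, ?_, ?_⟩
    · rw [← algebraMap_smul (GentleAlg k Q)ᵐᵒᵖ c w]; rfl
    · rw [← Algebra.smul_def, sub_self]; exact zero_mem _
  · intro u
    by_cases huv : u = v
    · subst huv
      refine ⟨1, by rw [hv, one_smul], ?_⟩
      rw [vertex_mul_self, one_smul, sub_self]
      exact zero_mem _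
    · refine ⟨0, ?_, ?_⟩
      · rw [← hv, ← mul_smul, ← op_mul, vertex_mul_of_ne k Q (Ne.symm huv), op_zero, zero_smul,
          zero_smul]
      · rw [vertex_mul_of_ne k Q huv, zero_smul, sub_self]
        exact zero_mem _
  · intro a
    refine ⟨0, by rw [ha, zero_smul], ?_⟩
    rw [zero_smul, sub_zero]
    by_cases hav : Q.tgt a = v
    · rw [← hav, arrow_mul_tgt]
      exact Submodule.subset_span ⟨a, rfl⟩
    · rw [← arrow_mul_tgt, mul_assoc, vertex_mul_of_ne k Q hav, mul_zero]
      exact zero_mem _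
  · rintro y z ⟨c, hc1, hc2⟩ ⟨d, hd1, hd2⟩
    refine ⟨c * d, ?_, ?_⟩
    · rw [op_mul, mul_smul, hc1, ← algebraMap_smul (GentleAlg k Q)ᵐᵒᵖ c w, ← mul_smul,
        ← Algebra.commutes, mul_smul, hd1, algebraMap_smul, mul_smul]
    · have h : y * z * vertex k Q v - (c * d) • vertex k Q v =
          y * (z * vertex k Q v - d • vertex k Q v) +
            algebraMap k (GentleAlg k Q) d * (y * vertex k Q v - c • vertex k Q v) := by
        rw [mul_sub, mul_sub, ← Algebra.smul_def, ← Algebra.smul_def, mul_smul_comm, smul_smul,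
          mul_comm d c, mul_assoc]
        abel
      rw [h]
      exact add_mem (Submodule.smul_mem _ _ hd2) (Submodule.smul_mem _ _ hc2)
  · rintro y z ⟨c, hc1, hc2⟩ ⟨d, hd1, hd2⟩
    refine ⟨c + d, by rw [MulOpposite.op_add, add_smul, add_smul, hc1, hd1], ?_⟩
    have h : (y + z) * vertex k Q v - (c + d) • vertex k Q v =
        (y * vertex k Q v - c • vertex k Q v) + (z * vertex k Q v - d • vertex k Q v) := by
      rw [add_mul, add_smul]; abel
    rw [h]
    exact add_mem hc2 hd2

lemma apply_eq_zero_of_mem_ker {φ : Cogen k Q}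
    (hφ : φ ∈ LinearMap.ker (LinearMap.pi fun a => toArrowDual k Q a)) {y : GentleAlg k Q}
    (hy : y ∈ Submodule.span (GentleAlg k Q) (Set.range (arrow k Q))) : φ (op y) = 0 := by
  have h : ∀ z, φ (op (z * y)) = 0 := by
    induction hy using Submodule.span_induction with
    | mem w hw =>
      obtain ⟨a, rfl⟩ := hw
      exact toArrowDual_eq_zero.1 (congrFun hφ a)
    | zero => intro z; rw [mul_zero, op_zero, map_zero]
    | add v w _ _ hv hw =>
      intro z; rw [mul_add, MulOpposite.op_add, map_add, hv, hw, add_zero]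
    | smul c w _ hw => intro z; rw [smul_eq_mul, ← mul_assoc]; exact hw _
  simpa using h 1

variable {Y : Type u} [AddCommGroup Y] [Module (GentleAlg k Q)ᵐᵒᵖ Y]

/-- The simple modules are direct summands of the socle of the dual of the regular module. -/
lemma extVanish_of_socle {i : ℕ}
    (hV : ExtVanish (GentleAlg k Q)ᵐᵒᵖ Y
      (LinearMap.ker (LinearMap.pi fun a => toArrowDual k Q a)) i)
    {K : Type u} [AddCommGroup K] [Module (GentleAlg k Q)ᵐᵒᵖ K] {w : K} {v : Q.V} (hw : w ≠ 0)
    (hv : op (vertex k Q v) • w = w) (ha : ∀ a, op (arrow k Q a) • w = 0)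
    (hK : ∀ x : K, ∃ b : (GentleAlg k Q)ᵐᵒᵖ, b • w = x) :
    ExtVanish (GentleAlg k Q)ᵐᵒᵖ Y K i := by
  let _ : Module k K := Module.compHom K (algebraMap k (GentleAlg k Q)ᵐᵒᵖ)
  have htower : IsScalarTower k (GentleAlg k Q)ᵐᵒᵖ K := ⟨fun c b x => by
    rw [Algebra.smul_def, mul_smul]; rfl⟩
  have hcomm : ∀ (b : (GentleAlg k Q)ᵐᵒᵖ) (c : k) (x : K), b • c • x = c • b • x :=
    fun b c x => by
      rw [← algebraMap_smul (GentleAlg k Q)ᵐᵒᵖ c x,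
        ← algebraMap_smul (GentleAlg k Q)ᵐᵒᵖ c (b • x), ← mul_smul, ← mul_smul, Algebra.commutes]
  have hspan : ∀ x : K, ∃ c : k, x = c • w := fun x => by
    obtain ⟨b, rfl⟩ := hK x
    obtain ⟨c, hc, -⟩ := exists_scalar_of_socle hv ha b.unop
    exact ⟨c, hc⟩
  obtain ⟨l, hl⟩ : ∃ l : K →ₗ[k] k, l w = 1 := by
    obtain ⟨l, hl⟩ := Module.Projective.exists_dual_ne_zero k hw
    exact ⟨(l w)⁻¹ • l, inv_mul_cancel₀ hl⟩
  let f : K →ₗ[(GentleAlg k Q)ᵐᵒᵖ]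
      LinearMap.ker (LinearMap.pi fun a => toArrowDual k Q a) :=
    (KDual.lift l).codRestrict _ fun x => by
      refine LinearMap.mem_ker.2 (funext fun a => toArrowDual_eq_zero.2 fun z => ?_)
      obtain ⟨c, hc⟩ := hspan (op z • x)
      rw [KDual.lift_apply, op_mul, mul_smul, hc, hcomm, ha, smul_zero, map_zero]
  let g : LinearMap.ker (LinearMap.pi fun a => toArrowDual k Q a) →ₗ[(GentleAlg k Q)ᵐᵒᵖ] K :=
    { toFun := fun φ => φ.1 (op (vertex k Q v)) • w
      map_add' := fun φ ψ => add_smul _ _ _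
      map_smul' := fun b φ => by
        obtain ⟨c, hc1, hc2⟩ := exists_scalar_of_socle hv ha b.unop
        have h := apply_eq_zero_of_mem_ker φ.2 hc2
        rw [MulOpposite.op_sub, map_sub, sub_eq_zero, MulOpposite.op_smul, map_smul, smul_eq_mul] at h
        have h' : (b • φ).1 (op (vertex k Q v)) = φ.1 (op (b.unop * vertex k Q v)) := rfl
        rw [op_unop] at hc1
        rw [h', h, RingHom.id_apply, hcomm, hc1, smul_smul, mul_comm] }
  refine extVanish_retract_right f g (LinearMap.ext fun x => ?_) hV
  obtain ⟨c, rfl⟩ := hspan x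
  change l (op (vertex k Q v) • c • w) • w = c • w
  rw [hcomm, hv, map_smul, hl, smul_eq_mul, mul_one]

lemma extVanish_of_ker [FiniteDimensional k (GentleAlg k Q)] {i : ℕ}
    (hV : ExtVanish (GentleAlg k Q)ᵐᵒᵖ Y
      (LinearMap.ker (LinearMap.pi fun a => toArrowDual k Q a)) i)
    (W : Type u) [AddCommGroup W] [Module (GentleAlg k Q)ᵐᵒᵖ W]
    [IsNoetherian (GentleAlg k Q)ᵐᵒᵖ W] : ExtVanish (GentleAlg k Q)ᵐᵒᵖ Y W i := by
  obtain ⟨N, hN, hmax⟩ := WellFounded.has_min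
    (wellFounded_gt (α := Submodule (GentleAlg k Q)ᵐᵒᵖ W))
    {N | ExtVanish (GentleAlg k Q)ᵐᵒᵖ Y N i} ⟨⊥, ExtVanish.of_subsingleton i⟩
  have htop : N = ⊤ := by
    by_contra hne
    have : Nontrivial (W ⧸ N) := Submodule.Quotient.nontrivial_iff.2 hne
    obtain ⟨w, v, hw, hv, ha⟩ := exists_socle_element (k := k) (Q := Q) (W ⧸ N)
    let K := Submodule.span (GentleAlg k Q)ᵐᵒᵖ {w}
    have hwK : w ∈ K := Submodule.mem_span_singleton_self w
    have hK : ExtVanish (GentleAlg k Q)ᵐᵒᵖ Y K i := by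
      refine extVanish_of_socle hV (w := ⟨w, hwK⟩) (v := v)
        (fun h => hw (congrArg Subtype.val h)) (Subtype.ext hv) (fun a => Subtype.ext (ha a))
        fun x => ?_
      obtain ⟨b, hb⟩ := Submodule.mem_span_singleton.1 x.2
      exact ⟨b, Subtype.ext hb⟩
    obtain ⟨f, g, hses⟩ := exists_isShortExact_comap_mkQ N K
    refine hmax (K.comap N.mkQ) (hses.extVanish_middle hN hK) 
      (lt_of_le_of_ne (Submodule.le_comap_mkQ N K) fun h => hw ?_)
    obtain ⟨y, rfl⟩ := N.mkQ_surjective w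
    exact (Submodule.Quotient.mk_eq_zero N).2 (h ▸ hwK)
  subst htop
  exact extVanish_retract_right (Submodule.topEquiv.symm.toLinearMap)
    (Submodule.topEquiv.toLinearMap) (LinearMap.ext fun _ => rfl) hN

/-- Over a finite-dimensional gentle algebra with `n` vertices, the modules of finite
projective dimension have projective dimension less than `2 * n`. -/
theorem extVanish_two_mul_card [FiniteDimensional k (GentleAlg k Q)] [Nonempty Q.V]
    (hY : FPD (GentleAlg k Q)ᵐᵒᵖ Y) (W : Type u) [AddCommGroup W]
    [Module (GentleAlg k Q)ᵐᵒᵖ W] [IsNoetherian (GentleAlg k Q)ᵐᵒᵖ W] :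
    ExtVanish (GentleAlg k Q)ᵐᵒᵖ Y W (2 * Fintype.card Q.V - 1 + 1) := by
  classical
  refine extVanish_of_ker (isShortExact_arrowDual.extVanish_left ?_ (extVanish_of_injective _)) W
  refine extVanish_sum_right (T := fun a : Q.E => arrowDual k Q a) Finset.univ
    (fun a => LinearMap.proj a) (fun a => LinearMap.single _ (fun a : Q.E => arrowDual k Q a) a)
    (LinearMap.ext fun x => ?_) fun a _ => ?_
  · rw [LinearMap.sum_apply]
    exact Finset.univ_sum_single x
  · have hcard := card_arrows_lt (k := k) (Q := Q)
    by_contra h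
    refine not_of_card_le (rel := Q.rel)
      (p := fun i a => ¬ ExtVanish (GentleAlg k Q)ᵐᵒᵖ Y (arrowDual k Q a) i)
      (fun i a => exists_rel_of_not_extVanish) (fun i a b hba h h' => h (extVanish_of_rel hba h'))
      ?_ (by omega) a h
    obtain ⟨D, hD⟩ := hY
    exact ⟨D, fun i hi a h => h (hD i hi _)⟩

end GlobalBound

end TiltingComplements

/-- A maximal partial-tilting module over a gentle algebra of rank `n`
(a partial-tilting module with exactly `n - 1` indecomposable direct summands) has only
finitely many isomorphism classes of complements, and in fact at most `2 * n` of them. -/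
theorem maximal_partial_tilting_complement_count
    (k : Type u) [Field k] [IsAlgClosed k]
    (Q : GentleQuiverData.{u}) (n : ℕ) (hn : 0 < n)
    (hfd : FiniteDimensional k (GentleAlg k Q))
    (hrank : Fintype.card Q.V = n)
    (M : ModuleCat.{u} (GentleAlg k Q)ᵐᵒᵖ)
    (hMfin : Module.Finite (GentleAlg k Q)ᵐᵒᵖ M)
    (hMpre : IsPreTilting M)
    (hMrk : HasRank M (n - 1))
    (hMpartial : ∃ N₀ : ModuleCat.{u} (GentleAlg k Q)ᵐᵒᵖ,
      Module.Finite (GentleAlg k Q)ᵐᵒᵖ N₀ ∧ IsTilting (dSum M N₀)) :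
    ∃ (m : ℕ) (N : Fin m → ModuleCat.{u} (GentleAlg k Q)ᵐᵒᵖ),
      m ≤ 2 * n ∧
      (∀ i j, i ≠ j → IsEmpty (N i ≃ₗ[(GentleAlg k Q)ᵐᵒᵖ] N j)) ∧
      (∀ i, IsComplement M (N i)) ∧
      (∀ X : ModuleCat.{u} (GentleAlg k Q)ᵐᵒᵖ, IsComplement M X →
        ∃ i, Nonempty (X ≃ₗ[(GentleAlg k Q)ᵐᵒᵖ] N i)) := by
  have : Module.Finite k (GentleAlg k Q)ᵐᵒᵖ := Module.Finite.equiv (MulOpposite.opLinearEquiv k)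
  have : IsNoetherianRing (GentleAlg k Q)ᵐᵒᵖ := IsNoetherianRing.of_finite k _
  have : IsArtinianRing (GentleAlg k Q)ᵐᵒᵖ := IsArtinianRing.of_finite k _
  have : Nonempty Q.V := Fintype.card_pos_iff.1 (hrank ▸ hn)
  obtain ⟨m, N, hm, hN⟩ := TiltingComplements.exists_complements k M hMfin
    (2 * Fintype.card Q.V - 1)
    fun Y W _ _ _ _ _ _ hY => TiltingComplements.extVanish_two_mul_card hY W
  exact ⟨m, N, by omega, hN⟩
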